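/- (Theorem 1) Let M0, Λ0 ∈ ℝ, M, L ∈ ℝ^8 and Λ a real symmetric 8×8 matrix, with associated 3HDM potential V. Then V admits a CP symmetry of order 4 if and only if all of the following hold: (i) Λ has a unit eigenvector v⁸ ∈ ℝ^8 which is self-aligned; (ii) there exist three mutually orthogonal eigenvectors v¹, v², v³ of Λ, each of which is orthogonal to v⁸ and f-orthogonal to v⁸; (iii) each of the four vectors M, L, K^{(1)}, K^{(2)} is a real scalar multiple of v⁸. -/

import Mathlib

open Matrix Complex BigOperators

noncomputable section

/-- The standard Gell-Mann matrices `λ₁,…,λ₈` (indexed by `Fin 8`). -/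
def gm : Fin 8 → Matrix (Fin 3) (Fin 3) ℂ
  | 0 => !![0, 1, 0; 1, 0, 0; 0, 0, 0]
  | 1 => !![0, -I, 0; I, 0, 0; 0, 0, 0]
  | 2 => !![1, 0, 0; 0, -1, 0; 0, 0, 0]
  | 3 => !![0, 0, 1; 0, 0, 0; 1, 0, 0]
  | 4 => !![0, 0, -I; 0, 0, 0; I, 0, 0]
  | 5 => !![0, 0, 0; 0, 0, 1; 0, 1, 0]
  | 6 => !![0, 0, 0; 0, 0, -I; 0, I, 0]
  | 7 => ((Real.sqrt 3 : ℂ))⁻¹ • !![1, 0, 0; 0, 1, 0; 0, 0, -2]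

/-- `t_i = λ_i / 2`. -/
def tm (i : Fin 8) : Matrix (Fin 3) (Fin 3) ℂ := (2 : ℂ)⁻¹ • gm i

/-- The real totally antisymmetric tensor `f_{ijk} = -2i · Tr([t_i,t_j]·t_k)`. -/
def fT (i j k : Fin 8) : ℝ := ((-2 * I) * ((tm i * tm j - tm j * tm i) * tm k).trace).re

/-- The real totally symmetric tensor `d_{ijk} = 2 · Tr({t_i,t_j}·t_k)`. -/
def dT (i j k : Fin 8) : ℝ := ((2 : ℂ) * ((tm i * tm j + tm j * tm i) * tm k).trace).re

/-- Hermitian inner product on `ℂ²`. -/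
def ip (x y : Fin 2 → ℂ) : ℂ := ∑ α, (starRingEnd ℂ) (x α) * y α

/-- The bilinear `r₀(φ) = (1/√3) Σ_a ⟨φ_a, φ_a⟩`. -/
def r0 (φ : Fin 3 → Fin 2 → ℂ) : ℝ := (Real.sqrt 3)⁻¹ * (∑ a, ip (φ a) (φ a)).re

/-- The bilinears `r_i(φ) = Σ_{a,b} (t_i)_{ab} ⟨φ_a, φ_b⟩`, `i = 1,…,8`. -/
def rv (i : Fin 8) (φ : Fin 3 → Fin 2 → ℂ) : ℝ := (∑ a, ∑ b, tm i a b * ip (φ a) (φ b)).re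

/-- The general 3HDM scalar potential in the bilinear formalism. -/
def pot (M0 Λ0 : ℝ) (M L : Fin 8 → ℝ) (Λ : Matrix (Fin 8) (Fin 8) ℝ)
    (φ : Fin 3 → Fin 2 → ℂ) : ℝ :=
  M0 * r0 φ + (∑ i, M i * rv i φ) + Λ0 * (r0 φ) ^ 2 + (∑ i, L i * r0 φ * rv i φ)
    + ∑ i, ∑ j, Λ i j * rv i φ * rv j φ

/-- `V` admits a CP symmetry of order 4: a unitary `X` with `X·conj X ≠ 1`,
`(X·conj X)² = 1` and `V(X·conj φ) = V(φ)` for all `φ`. -/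
def HasCP4 (M0 Λ0 : ℝ) (M L : Fin 8 → ℝ) (Λ : Matrix (Fin 8) (Fin 8) ℝ) : Prop :=
  ∃ X : Matrix (Fin 3) (Fin 3) ℂ, X * Xᴴ = 1 ∧
    X * X.map (starRingEnd ℂ) ≠ 1 ∧ (X * X.map (starRingEnd ℂ)) ^ 2 = 1 ∧
    ∀ φ : Fin 3 → Fin 2 → ℂ,
      pot M0 Λ0 M L Λ (fun a α => ∑ b, X a b * (starRingEnd ℂ) (φ b α)) = pot M0 Λ0 M L Λ φ

/-- `K⁽ⁿ⁾_i = Σ_{j,k} d_{ijk} (Λⁿ)_{jk}`. -/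
def Kvec (Λ : Matrix (Fin 8) (Fin 8) ℝ) (n : ℕ) : Fin 8 → ℝ :=
  fun i => ∑ j, ∑ k, dT i j k * (Λ ^ n) j k

/-- The star product `(a∗b)_i = √3 Σ_{j,k} d_{ijk} a_j b_k`. -/
def starP (a b : Fin 8 → ℝ) : Fin 8 → ℝ :=
  fun i => Real.sqrt 3 * ∑ j, ∑ k, dT i j k * a j * b k

/-- A vector `v ∈ ℝ⁸` is self-aligned if `√3 Σ_{j,k} d_{ijk} v_j v_k` is a real
scalar multiple of `v`. -/
def SelfAligned (v : Fin 8 → ℝ) : Prop :=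
  ∃ c : ℝ, (fun i => Real.sqrt 3 * ∑ j, ∑ k, dT i j k * v j * v k) = c • v

/-- `u, v ∈ ℝ⁸` are f-orthogonal if `Σ_{j,k} f_{ijk} u_j v_k = 0` for all `i`. -/
def FOrth (u v : Fin 8 → ℝ) : Prop := ∀ i : Fin 8, ∑ j, ∑ k, fT i j k * u j * v k = 0

/-- The canonical order-4 CP matrix `X = [[0,1,0],[-1,0,0],[0,0,1]]`. -/
def Xcp4 : Matrix (Fin 3) (Fin 3) ℂ := !![0, 1, 0; -1, 0, 0; 0, 0, 1]

/-- The real-linear functionals `A ↦ Re Tr (t_i A)`. -/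
def tcoef (A : Matrix (Fin 3) (Fin 3) ℂ) (i : Fin 8) : ℝ := (tm i * A).trace.re

/-- The traceless Hermitian matrix `∑ v_i t_i`. -/
def hmat (v : Fin 8 → ℝ) : Matrix (Fin 3) (Fin 3) ℂ := ∑ i, v i • tm i

/-- The real `8 × 8` matrix of a map of `3 × 3` matrices in the basis `t_i`. -/
def rot (θ : Matrix (Fin 3) (Fin 3) ℂ →⋆ₐ[ℝ] Matrix (Fin 3) (Fin 3) ℂ) :
    Matrix (Fin 8) (Fin 8) ℝ :=
  Matrix.of fun i j => 2 * tcoef (θ (tm j)) i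

lemma sqrt_three_mul_self : Real.sqrt 3 * Real.sqrt 3 = 3 :=
  Real.mul_self_sqrt (by norm_num)

lemma tm_isHermitian (i : Fin 8) : (tm i).IsHermitian := by
  ext a b
  fin_cases i <;> fin_cases a <;> fin_cases b <;> simp [tm, gm]

lemma trace_tm (i : Fin 8) : (tm i).trace = 0 := by
  fin_cases i <;> simp [tm, gm, Matrix.trace_fin_three]
  ring

lemma tcoef_eq (A : Matrix (Fin 3) (Fin 3) ℂ) :
    tcoef A = ![((A 0 1).re + (A 1 0).re) / 2, ((A 1 0).im - (A 0 1).im) / 2,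
      ((A 0 0).re - (A 1 1).re) / 2, ((A 0 2).re + (A 2 0).re) / 2,
      ((A 2 0).im - (A 0 2).im) / 2, ((A 1 2).re + (A 2 1).re) / 2,
      ((A 2 1).im - (A 1 2).im) / 2,
      Real.sqrt 3 / 6 * ((A 0 0).re + (A 1 1).re - 2 * (A 2 2).re)] := by
  ext i
  fin_cases i <;>
    simp [tcoef, tm, gm, Matrix.trace_fin_three, Matrix.vecMul, dotProduct,
      Fin.sum_univ_three] <;> ring

lemma hmat_eq (v : Fin 8 → ℝ) :
    hmat v = !![(⟨v 2 / 2 + Real.sqrt 3 / 6 * v 7, 0⟩ : ℂ), ⟨v 0 / 2, -v 1 / 2⟩,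
        ⟨v 3 / 2, -v 4 / 2⟩;
      ⟨v 0 / 2, v 1 / 2⟩, ⟨-v 2 / 2 + Real.sqrt 3 / 6 * v 7, 0⟩, ⟨v 5 / 2, -v 6 / 2⟩;
      ⟨v 3 / 2, v 4 / 2⟩, ⟨v 5 / 2, v 6 / 2⟩, ⟨-(Real.sqrt 3 / 3 * v 7), 0⟩] := by
  ext a b
  fin_cases a <;> fin_cases b <;> apply Complex.ext <;>
    simp [hmat, tm, gm, Fin.sum_univ_eight, Matrix.add_apply] <;> ring

lemma hmat_single (i : Fin 8) : hmat (Pi.single i 1) = tm i := by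
  simp [hmat, Pi.single_apply]

lemma tcoef_hmat (v : Fin 8 → ℝ) (i : Fin 8) : 2 * tcoef (hmat v) i = v i := by
  have h := sqrt_three_mul_self
  rw [tcoef_eq, hmat_eq]
  fin_cases i <;> simp <;> grind

lemma tcoef_tm (i j : Fin 8) : 2 * tcoef (tm j) i = if i = j then 1 else 0 := by
  rw [← hmat_single, tcoef_hmat, Pi.single_apply]

lemma hermitian_eq {A : Matrix (Fin 3) (Fin 3) ℂ} (hA : A.IsHermitian) :
    A = (A.trace.re / 3) • (1 : Matrix (Fin 3) (Fin 3) ℂ) + hmat (fun i => 2 * tcoef A i) := by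
  have h := sqrt_three_mul_self
  have hre : ∀ a b, (A a b).re = (A b a).re := fun a b => by
    conv_lhs => rw [← hA.apply a b]
    simp
  have him : ∀ a b, (A a b).im = -(A b a).im := fun a b => by
    conv_lhs => rw [← hA.apply a b]
    simp
  have h00 := him 0 0
  have h11 := him 1 1
  have h22 := him 2 2
  have := hre 0 1; have := hre 0 2; have := hre 1 2
  have := him 0 1; have := him 0 2; have := him 1 2
  rw [hmat_eq, tcoef_eq]
  ext a b
  apply Complex.ext <;> fin_cases a <;> fin_cases b <;>
    simp [Matrix.trace_fin_three, Matrix.add_apply, Matrix.smul_apply] <;> grind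

lemma hmat_isHermitian (v : Fin 8 → ℝ) : (hmat v).IsHermitian := by
  simp only [hmat, Matrix.IsHermitian, Matrix.conjTranspose_sum, Matrix.conjTranspose_smul,
    (tm_isHermitian _).eq, star_trivial]

lemma hmat_smul (c : ℝ) (v : Fin 8 → ℝ) : hmat (c • v) = c • hmat v := by
  simp [hmat, mul_smul, Finset.smul_sum]

lemma hmat_injective : Function.Injective hmat := fun v w h => by
  ext i
  rw [← tcoef_hmat v, h, tcoef_hmat]

lemma tcoef_add (A B : Matrix (Fin 3) (Fin 3) ℂ) : tcoef (A + B) = tcoef A + tcoef B := by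
  ext i
  simp [tcoef, mul_add]

lemma tcoef_smul (c : ℝ) (A : Matrix (Fin 3) (Fin 3) ℂ) : tcoef (c • A) = c • tcoef A := by
  ext i
  simp [tcoef]

lemma tcoef_one : tcoef 1 = 0 := by
  ext i
  simp [tcoef, trace_tm]

lemma two_tcoef_eq {c : ℝ} (v : Fin 8 → ℝ) :
    (fun i => 2 * tcoef (c • (1 : Matrix (Fin 3) (Fin 3) ℂ) + hmat v) i) = v := by
  ext i
  rw [tcoef_add, tcoef_smul, tcoef_one]
  simp [tcoef_hmat]

lemma eq_hmat {A : Matrix (Fin 3) (Fin 3) ℂ} (hA : A.IsHermitian) (h : A.trace.re = 0) :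
    A = hmat (fun i => 2 * tcoef A i) := by
  conv_lhs => rw [hermitian_eq hA, h]
  simp

section StarHom

variable {θ θ' : Matrix (Fin 3) (Fin 3) ℂ →⋆ₐ[ℝ] Matrix (Fin 3) (Fin 3) ℂ}

lemma isHermitian_map {A : Matrix (Fin 3) (Fin 3) ℂ} (hA : A.IsHermitian) :
    (θ A).IsHermitian := by
  rw [Matrix.IsHermitian, ← Matrix.star_eq_conjTranspose, ← map_star,
    Matrix.star_eq_conjTranspose, hA.eq]

lemma map_tm (hθ : ∀ A, (θ A).trace.re = A.trace.re) (j : Fin 8) :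
    θ (tm j) = hmat (fun i => rot θ i j) :=
  eq_hmat (isHermitian_map (tm_isHermitian j)) (by rw [hθ, trace_tm, Complex.zero_re])

lemma map_hmat (hθ : ∀ A, (θ A).trace.re = A.trace.re) (v : Fin 8 → ℝ) :
    θ (hmat v) = hmat (rot θ *ᵥ v) := by
  simp only [hmat, map_sum, map_smul, map_tm hθ, Finset.smul_sum, Matrix.mulVec, dotProduct,
    Finset.sum_smul]
  rw [Finset.sum_comm]
  simp only [smul_smul, mul_comm]

lemma two_tcoef_map (hθ : ∀ A, (θ A).trace.re = A.trace.re) {A : Matrix (Fin 3) (Fin 3) ℂ}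
    (hA : A.IsHermitian) :
    (fun i => 2 * tcoef (θ A) i) = rot θ *ᵥ (fun i => 2 * tcoef A i) := by
  conv_lhs => rw [hermitian_eq hA, map_add, map_smul, map_one, map_hmat hθ, two_tcoef_eq]

lemma tcoef_map (hθ : ∀ A, (θ A).trace.re = A.trace.re) {A : Matrix (Fin 3) (Fin 3) ℂ}
    (hA : A.IsHermitian) : tcoef (θ A) = rot θ *ᵥ tcoef A := by
  have h := two_tcoef_map hθ hA
  have h2 : (fun i => 2 * tcoef A i) = (2 : ℝ) • tcoef A := rfl
  rw [h2, Matrix.mulVec_smul] at h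
  ext i
  have := congrFun h i
  simpa using this

lemma rot_comp (hθ : ∀ A, (θ A).trace.re = A.trace.re) :
    rot (θ.comp θ') = rot θ * rot θ' := by
  ext i j
  exact congrFun (two_tcoef_map hθ (isHermitian_map (θ := θ') (tm_isHermitian j))) i

lemma rot_eq_one (h : ∀ A, θ A = A) : rot θ = 1 := by
  ext i j
  rw [rot, Matrix.of_apply, h, tcoef_tm, Matrix.one_apply]

lemma trace_hmat_mul_hmat (v w : Fin 8 → ℝ) :
    2 * (hmat v * hmat w).trace.re = v ⬝ᵥ w := by
  conv_lhs => rw [hmat]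
  simp only [Finset.sum_mul, Matrix.trace_sum, Complex.re_sum, smul_mul_assoc, Matrix.trace_smul,
    Complex.real_smul, Complex.re_ofReal_mul, Finset.mul_sum, dotProduct]
  refine Finset.sum_congr rfl fun i _ => ?_
  rw [← tcoef_hmat w i, tcoef]
  ring

lemma rot_transpose_mul_rot (hθ : ∀ A, (θ A).trace.re = A.trace.re) :
    (rot θ)ᵀ * rot θ = 1 := by
  ext i j
  have h : 2 * (θ (tm i * tm j)).trace.re = 2 * (tm i * tm j).trace.re := by rw [hθ]
  rw [map_mul, map_tm hθ, map_tm hθ, trace_hmat_mul_hmat] at h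
  rw [Matrix.mul_apply, Matrix.one_apply, ← tcoef_tm i j]
  exact h

lemma rot_mul_rot_transpose (hθ : ∀ A, (θ A).trace.re = A.trace.re) :
    rot θ * (rot θ)ᵀ = 1 :=
  mul_eq_one_comm.mp (rot_transpose_mul_rot hθ)

/-- The Hermitian matrix `∑ S_{jk} {t_j, t_k}`. -/
def acomm (S : Matrix (Fin 8) (Fin 8) ℝ) : Matrix (Fin 3) (Fin 3) ℂ :=
  ∑ j, ∑ k, S j k • (tm j * tm k + tm k * tm j)

lemma dT_eq (i j k : Fin 8) : dT i j k = 2 * tcoef (tm j * tm k + tm k * tm j) i := by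
  have h1 : (tm i * tm j * tm k).trace = (tm i * (tm j * tm k)).trace := by rw [mul_assoc]
  have h2 : (tm j * tm i * tm k).trace = (tm i * (tm k * tm j)).trace := by
    rw [mul_assoc, Matrix.trace_mul_comm, mul_assoc]
  rw [dT, tcoef, add_mul, Matrix.trace_add, h1, h2, ← Matrix.trace_add, ← mul_add]
  simp

lemma sum_dT_eq (S : Matrix (Fin 8) (Fin 8) ℝ) (i : Fin 8) :
    ∑ j, ∑ k, dT i j k * S j k = 2 * tcoef (acomm S) i := by
  simp only [acomm, tcoef, Matrix.trace_sum, Complex.re_sum, Finset.mul_sum]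
  refine Finset.sum_congr rfl fun j _ => Finset.sum_congr rfl fun k _ => ?_
  rw [dT_eq, mul_smul_comm, Matrix.trace_smul, Complex.real_smul, Complex.re_ofReal_mul, tcoef]
  ring

lemma acomm_isHermitian (S : Matrix (Fin 8) (Fin 8) ℝ) : (acomm S).IsHermitian := by
  simp only [acomm, Matrix.IsHermitian, Matrix.conjTranspose_sum, Matrix.conjTranspose_smul,
    Matrix.conjTranspose_add, Matrix.conjTranspose_mul, (tm_isHermitian _).eq, star_trivial]
  simp only [add_comm]

lemma hmat_mul_hmat (v w : Fin 8 → ℝ) :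
    hmat v * hmat w = ∑ a, ∑ b, (v a * w b) • (tm a * tm b) := by
  simp only [hmat, Finset.sum_mul_sum, smul_mul_smul_comm]

lemma sum_comm_four {ι M : Type*} [Fintype ι] [AddCommMonoid M] (F : ι → ι → ι → ι → M) :
    ∑ j, ∑ k, ∑ a, ∑ b, F j k a b = ∑ a, ∑ b, ∑ k, ∑ j, F j k a b := by
  calc ∑ j, ∑ k, ∑ a, ∑ b, F j k a b = ∑ j, ∑ a, ∑ b, ∑ k, F j k a b := by
        refine Finset.sum_congr rfl fun j _ => ?_
        rw [Finset.sum_comm]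
        exact Finset.sum_congr rfl fun a _ => Finset.sum_comm
    _ = ∑ a, ∑ b, ∑ k, ∑ j, F j k a b := by
        rw [Finset.sum_comm]
        refine Finset.sum_congr rfl fun a _ => ?_
        rw [Finset.sum_comm]
        exact Finset.sum_congr rfl fun b _ => Finset.sum_comm

lemma map_acomm (hθ : ∀ A, (θ A).trace.re = A.trace.re) (S : Matrix (Fin 8) (Fin 8) ℝ) :
    θ (acomm S) = acomm (rot θ * S * (rot θ)ᵀ) := by
  have h1 : ∀ j k, θ (tm j * tm k + tm k * tm j) =
      ∑ a, ∑ b, (rot θ a j * rot θ b k) • (tm a * tm b + tm b * tm a) := fun j k => by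
    rw [map_add, map_mul, map_mul, map_tm hθ, map_tm hθ, hmat_mul_hmat, hmat_mul_hmat]
    simp only [smul_add, Finset.sum_add_distrib]
    congr 1
    rw [Finset.sum_comm]
    simp only [mul_comm]
  simp only [acomm, map_sum, map_smul, h1, Matrix.mul_apply, Matrix.transpose_apply,
    Finset.sum_mul, Finset.sum_smul, Finset.smul_sum, smul_smul]
  rw [sum_comm_four]
  refine Finset.sum_congr rfl fun a _ => Finset.sum_congr rfl fun b _ =>
    Finset.sum_congr rfl fun k _ => Finset.sum_congr rfl fun j _ => ?_
  congr 1
  ring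

lemma Kvec_eq (Λ : Matrix (Fin 8) (Fin 8) ℝ) (n : ℕ) :
    Kvec Λ n = fun i => 2 * tcoef (acomm (Λ ^ n)) i :=
  funext fun i => sum_dT_eq (Λ ^ n) i

lemma Kvec_conj (hθ : ∀ A, (θ A).trace.re = A.trace.re) (Λ : Matrix (Fin 8) (Fin 8) ℝ) (n : ℕ) :
    Kvec (rot θ * Λ * (rot θ)ᵀ) n = rot θ *ᵥ Kvec Λ n := by
  have h : (rot θ * Λ * (rot θ)ᵀ) ^ n = rot θ * Λ ^ n * (rot θ)ᵀ := by
    induction n with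
    | zero => simp [rot_mul_rot_transpose hθ]
    | succ n ih =>
      rw [pow_succ, ih, pow_succ]
      simp only [mul_assoc]
      rw [← mul_assoc (rot θ)ᵀ (rot θ), rot_transpose_mul_rot hθ, one_mul]
  rw [Kvec_eq, Kvec_eq, h, ← map_acomm hθ, two_tcoef_map hθ (acomm_isHermitian _)]

end StarHom

lemma selfAligned_iff (v : Fin 8 → ℝ) :
    SelfAligned v ↔ ∃ α β : ℝ, hmat v * hmat v = α • 1 + β • hmat v := by
  have key : (fun i => Real.sqrt 3 * ∑ j, ∑ k, dT i j k * v j * v k) =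
      fun i => (2 * Real.sqrt 3) * (2 * tcoef (hmat v * hmat v) i) := by
    ext i
    have h : acomm (Matrix.vecMulVec v v) = (2 : ℝ) • (hmat v * hmat v) := by
      simp only [acomm, Matrix.vecMulVec_apply, hmat_mul_hmat, smul_add, Finset.sum_add_distrib,
        two_smul]
      congr 1
      rw [Finset.sum_comm]
      simp only [mul_comm]
    have h2 := sum_dT_eq (Matrix.vecMulVec v v) i
    rw [h, tcoef_smul] at h2
    simp only [Matrix.vecMulVec_apply, ← mul_assoc, Pi.smul_apply, smul_eq_mul] at h2
    rw [h2]
    ring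
  have hs : (2 * Real.sqrt 3) ≠ 0 := by positivity
  have hh : (hmat v * hmat v).IsHermitian := by
    rw [Matrix.IsHermitian, Matrix.conjTranspose_mul, (hmat_isHermitian v).eq]
  rw [SelfAligned, key]
  constructor
  · rintro ⟨c, hc⟩
    refine ⟨(hmat v * hmat v).trace.re / 3, c / (2 * Real.sqrt 3), ?_⟩
    conv_lhs => rw [hermitian_eq hh]
    rw [← hmat_smul]
    congr 2
    ext i
    have := congrFun hc i
    simp only [Pi.smul_apply, smul_eq_mul] at this ⊢
    field_simp
    linarith
  · rintro ⟨α, β, h⟩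
    refine ⟨2 * Real.sqrt 3 * β, ?_⟩
    rw [h, ← hmat_smul]
    ext i
    rw [congrFun (two_tcoef_eq (β • v)) i]
    simp [mul_assoc]

lemma fOrth_iff (u v : Fin 8 → ℝ) : FOrth u v ↔ hmat u * hmat v = hmat v * hmat u := by
  have key : ∀ i, ∑ j, ∑ k, fT i j k * u j * v k =
      2 * tcoef (-I • (hmat u * hmat v - hmat v * hmat u)) i := fun i => by
    have h1 : ∀ j k, fT i j k = 2 * tcoef (-I • (tm j * tm k - tm k * tm j)) i := fun j k => by
      have h1 : (tm i * tm j * tm k).trace = (tm i * (tm j * tm k)).trace := by rw [mul_assoc]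
      have h2 : (tm j * tm i * tm k).trace = (tm i * (tm k * tm j)).trace := by
        rw [mul_assoc, Matrix.trace_mul_comm, mul_assoc]
      rw [fT, tcoef, sub_mul, Matrix.trace_sub, h1, h2, mul_smul_comm, Matrix.trace_smul,
        mul_sub (tm i), Matrix.trace_sub]
      simp
    have h2 : hmat u * hmat v - hmat v * hmat u =
        ∑ j, ∑ k, (u j * v k) • (tm j * tm k - tm k * tm j) := by
      simp only [hmat_mul_hmat, smul_sub, Finset.sum_sub_distrib]
      congr 1
      rw [Finset.sum_comm]
      simp only [mul_comm]
    simp only [h1, h2, tcoef, Finset.smul_sum, Finset.mul_sum, Matrix.trace_sum, Complex.re_sum]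
    refine Finset.sum_congr rfl fun j _ => Finset.sum_congr rfl fun k _ => ?_
    rw [smul_comm, mul_smul_comm (u j * v k), Matrix.trace_smul, Complex.real_smul,
      Complex.re_ofReal_mul]
    ring
  simp only [FOrth, key]
  constructor
  · intro h
    have hherm : (-I • (hmat u * hmat v - hmat v * hmat u)).IsHermitian := by
      rw [Matrix.IsHermitian, Matrix.conjTranspose_smul, Matrix.conjTranspose_sub,
        Matrix.conjTranspose_mul, Matrix.conjTranspose_mul, (hmat_isHermitian u).eq,
        (hmat_isHermitian v).eq]
      simp only [neg_smul, RCLike.star_def, map_neg, Complex.conj_I, neg_neg]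
      rw [← smul_neg, neg_sub]
    have h0 := eq_hmat hherm (by
      rw [Matrix.trace_smul, Matrix.trace_sub, Matrix.trace_mul_comm, sub_self]; simp)
    simp only [h] at h0
    have h1 : hmat (fun _ => 0) = 0 := by simp [hmat]
    rw [h1, smul_eq_zero] at h0
    rcases h0 with h0 | h0
    · simp at h0
    · exact sub_eq_zero.mp h0
  · intro h i
    simp [h, tcoef]

/-- Conjugation `A ↦ U A U†` by a unitary matrix. -/
def adHom (U : Matrix (Fin 3) (Fin 3) ℂ) (hU : U * Uᴴ = 1) :
    Matrix (Fin 3) (Fin 3) ℂ →⋆ₐ[ℝ] Matrix (Fin 3) (Fin 3) ℂ where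
  toFun A := U * A * Uᴴ
  map_one' := by rw [mul_one, hU]
  map_mul' A B := by
    have h : U * A * Uᴴ * (U * B * Uᴴ) = U * A * (Uᴴ * U) * B * Uᴴ := by simp only [mul_assoc]
    rw [h, mul_eq_one_comm.mp hU, mul_one]
    simp only [mul_assoc]
  map_zero' := by simp
  map_add' A B := by rw [mul_add, add_mul]
  commutes' c := by
    rw [Algebra.algebraMap_eq_smul_one, mul_smul_comm, mul_one, smul_mul_assoc, hU]
  map_star' A := by simp [Matrix.star_eq_conjTranspose, mul_assoc]

/-- Entrywise complex conjugation of matrices. -/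
def mconj : Matrix (Fin 3) (Fin 3) ℂ →⋆ₐ[ℝ] Matrix (Fin 3) (Fin 3) ℂ where
  toFun A := A.map (starRingEnd ℂ)
  map_one' := by simp
  map_mul' A B := Matrix.map_mul
  map_zero' := by simp
  map_add' A B := by ext; simp
  commutes' c := by
    ext a b
    simp [Algebra.algebraMap_eq_smul_one, Matrix.one_apply, Matrix.smul_apply, apply_ite]
    split <;> simp_all
  map_star' A := by ext; simp

/-- The action `A ↦ X conj(A) X†` of a generalized CP transformation. -/
def cpHom (X : Matrix (Fin 3) (Fin 3) ℂ) (hX : X * Xᴴ = 1) :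
    Matrix (Fin 3) (Fin 3) ℂ →⋆ₐ[ℝ] Matrix (Fin 3) (Fin 3) ℂ :=
  (adHom X hX).comp mconj

lemma adHom_apply {U : Matrix (Fin 3) (Fin 3) ℂ} (hU : U * Uᴴ = 1)
    (A : Matrix (Fin 3) (Fin 3) ℂ) : adHom U hU A = U * A * Uᴴ := rfl

lemma cpHom_apply {X : Matrix (Fin 3) (Fin 3) ℂ} (hX : X * Xᴴ = 1)
    (A : Matrix (Fin 3) (Fin 3) ℂ) : cpHom X hX A = X * A.map (starRingEnd ℂ) * Xᴴ := rfl

lemma trace_adHom {U : Matrix (Fin 3) (Fin 3) ℂ} (hU : U * Uᴴ = 1)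
    (A : Matrix (Fin 3) (Fin 3) ℂ) : (adHom U hU A).trace.re = A.trace.re := by
  rw [adHom_apply, mul_assoc, Matrix.trace_mul_comm, mul_assoc, mul_eq_one_comm.mp hU, mul_one]

lemma trace_cpHom {X : Matrix (Fin 3) (Fin 3) ℂ} (hX : X * Xᴴ = 1)
    (A : Matrix (Fin 3) (Fin 3) ℂ) : (cpHom X hX A).trace.re = A.trace.re := by
  rw [cpHom, StarAlgHom.comp_apply, trace_adHom hX]
  simp [mconj, Matrix.trace_fin_three]

/-- The matrix `φ φ†` of a field configuration. -/
def pmat (φ : Fin 3 → Fin 2 → ℂ) : Matrix (Fin 3) (Fin 3) ℂ :=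
  (Matrix.of φ : Matrix (Fin 3) (Fin 2) ℂ) * (Matrix.of φ : Matrix (Fin 3) (Fin 2) ℂ)ᴴ

lemma pmat_isHermitian (φ : Fin 3 → Fin 2 → ℂ) : (pmat φ).IsHermitian :=
  Matrix.isHermitian_mul_conjTranspose_self _

lemma r0_eq (φ : Fin 3 → Fin 2 → ℂ) : r0 φ = (Real.sqrt 3)⁻¹ * (pmat φ).trace.re := by
  rw [r0]
  congr 2
  refine Finset.sum_congr rfl fun a _ => ?_
  simp [ip, pmat, Matrix.mul_apply, mul_comm]

lemma rv_eq (φ : Fin 3 → Fin 2 → ℂ) (i : Fin 8) : rv i φ = tcoef (pmat φ) i := by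
  rw [rv, tcoef, Matrix.trace]
  congr 1
  refine Finset.sum_congr rfl fun a _ => ?_
  rw [Matrix.diag_apply, Matrix.mul_apply]
  refine Finset.sum_congr rfl fun b _ => ?_
  simp [ip, pmat, Matrix.mul_apply, mul_comm]

lemma pmat_cp {X : Matrix (Fin 3) (Fin 3) ℂ} (hX : X * Xᴴ = 1) (φ : Fin 3 → Fin 2 → ℂ) :
    pmat (fun a α => ∑ b, X a b * (starRingEnd ℂ) (φ b α)) = cpHom X hX (pmat φ) := by
  have h : (Matrix.of fun a α => ∑ b, X a b * (starRingEnd ℂ) (φ b α) :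
      Matrix (Fin 3) (Fin 2) ℂ) = X * (Matrix.of φ).map (starRingEnd ℂ) := by
    ext a α
    simp [Matrix.mul_apply]
  rw [pmat, h, cpHom_apply, pmat, Matrix.map_mul, Matrix.conjTranspose_mul]
  simp only [mul_assoc, Matrix.mul_assoc]
  congr 2

lemma pot_eq (M0 Λ0 : ℝ) (M L : Fin 8 → ℝ) (Λ : Matrix (Fin 8) (Fin 8) ℝ)
    (φ : Fin 3 → Fin 2 → ℂ) :
    pot M0 Λ0 M L Λ φ = M0 * r0 φ + M ⬝ᵥ tcoef (pmat φ) + Λ0 * r0 φ ^ 2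
      + r0 φ * (L ⬝ᵥ tcoef (pmat φ)) + tcoef (pmat φ) ⬝ᵥ Λ *ᵥ tcoef (pmat φ) := by
  simp only [pot, rv_eq, dotProduct, Matrix.mulVec, Finset.mul_sum]
  congr 1
  · congr 1
    exact Finset.sum_congr rfl fun i _ => by ring
  · exact Finset.sum_congr rfl fun i _ => Finset.sum_congr rfl fun j _ => by ring

lemma pot_cp (M0 Λ0 : ℝ) (M L : Fin 8 → ℝ) (Λ : Matrix (Fin 8) (Fin 8) ℝ)
    {X : Matrix (Fin 3) (Fin 3) ℂ} (hX : X * Xᴴ = 1) (φ : Fin 3 → Fin 2 → ℂ) :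
    pot M0 Λ0 M L Λ (fun a α => ∑ b, X a b * (starRingEnd ℂ) (φ b α)) =
      pot M0 Λ0 ((rot (cpHom X hX))ᵀ *ᵥ M) ((rot (cpHom X hX))ᵀ *ᵥ L)
        ((rot (cpHom X hX))ᵀ * Λ * rot (cpHom X hX)) φ := by
  have h0 : r0 (fun a α => ∑ b, X a b * (starRingEnd ℂ) (φ b α)) = r0 φ := by
    rw [r0_eq, r0_eq, pmat_cp hX, trace_cpHom hX]
  have h1 : ∀ (R : Matrix (Fin 8) (Fin 8) ℝ) (v w : Fin 8 → ℝ),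
      (Rᵀ *ᵥ v) ⬝ᵥ w = v ⬝ᵥ R *ᵥ w := fun R v w => by
    rw [Matrix.mulVec_transpose, Matrix.dotProduct_mulVec]
  rw [pot_eq, pot_eq, h0, pmat_cp hX, tcoef_map (trace_cpHom hX) (pmat_isHermitian φ), h1, h1,
    ← Matrix.mulVec_mulVec, ← Matrix.mulVec_mulVec, dotProduct_comm _ ((rot (cpHom X hX))ᵀ *ᵥ _),
    h1, dotProduct_comm _ (Λ *ᵥ _)]

lemma eq_zero_of_isLinearMap {f : Matrix (Fin 3) (Fin 3) ℂ → ℝ} (hf : IsLinearMap ℝ f)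
    (h : ∀ u, f (Matrix.vecMulVec u (star u)) = 0) {A : Matrix (Fin 3) (Fin 3) ℂ}
    (hA : A.IsHermitian) : f A = 0 := by
  have hs : A = ∑ k, hA.eigenvalues k • Matrix.vecMulVec
      ((hA.eigenvectorUnitary : Matrix (Fin 3) (Fin 3) ℂ).col k)
      (star ((hA.eigenvectorUnitary : Matrix (Fin 3) (Fin 3) ℂ).col k)) := by
    conv_lhs => rw [hA.spectral_theorem, Unitary.conjStarAlgAut_apply]
    ext a b
    rw [Matrix.mul_apply, Matrix.sum_apply]
    refine Finset.sum_congr rfl fun k _ => ?_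
    simp [Matrix.vecMulVec_apply]
    ring
  rw [hs, ← hf.mk'_apply, map_sum]
  simp [h]

lemma pot_eq_iff (M0 Λ0 : ℝ) (M M' L L' : Fin 8 → ℝ) {Λ Λ' : Matrix (Fin 8) (Fin 8) ℝ}
    (hΛ : Λ.IsSymm) (hΛ' : Λ'.IsSymm) :
    (∀ φ, pot M0 Λ0 M' L' Λ' φ = pot M0 Λ0 M L Λ φ) ↔ M' = M ∧ L' = L ∧ Λ' = Λ := by
  refine ⟨fun h => ?_, fun ⟨h1, h2, h3⟩ φ => by rw [h1, h2, h3]⟩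
  set m := M' - M with hm
  set l := L' - L with hl
  set S := Λ' - Λ with hS
  have hSs : S.IsSymm := hΛ'.sub hΛ
  have hD : ∀ φ, m ⬝ᵥ tcoef (pmat φ) + (r0 φ * (l ⬝ᵥ tcoef (pmat φ))
      + tcoef (pmat φ) ⬝ᵥ S *ᵥ tcoef (pmat φ)) = 0 := fun φ => by
    have := h φ
    rw [pot_eq, pot_eq] at this
    simp only [hm, hl, hS, sub_dotProduct, Matrix.sub_mulVec, dotProduct_sub]
    linarith
  have hscale : ∀ φ, pmat (fun a α => 2 * φ a α) = (4 : ℝ) • pmat φ := fun φ => by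
    ext a b
    simp [pmat, Matrix.mul_apply, Matrix.smul_apply]
    ring
  have hlin : ∀ φ, m ⬝ᵥ tcoef (pmat φ) = 0 ∧ r0 φ * (l ⬝ᵥ tcoef (pmat φ))
      + tcoef (pmat φ) ⬝ᵥ S *ᵥ tcoef (pmat φ) = 0 := fun φ => by
    have h1 := hD φ
    have h2 := hD (fun a α => 2 * φ a α)
    rw [r0_eq, hscale, tcoef_smul, Matrix.trace_smul, Complex.real_smul, Complex.re_ofReal_mul,
      mul_left_comm, ← r0_eq] at h2
    simp only [dotProduct_smul, smul_dotProduct, Matrix.mulVec_smul, smul_eq_mul] at h2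
    constructor <;> linarith
  let B : Matrix (Fin 3) (Fin 3) ℂ → Matrix (Fin 3) (Fin 3) ℂ → ℝ := fun A A' =>
    2⁻¹ * ((Real.sqrt 3)⁻¹ * A.trace.re * (l ⬝ᵥ tcoef A')
      + (Real.sqrt 3)⁻¹ * A'.trace.re * (l ⬝ᵥ tcoef A)) + tcoef A ⬝ᵥ S *ᵥ tcoef A'
  have hB2 : ∀ A, IsLinearMap ℝ (B A) := fun A => by
    constructor
    · intro A₁ A₂
      simp only [B, tcoef_add, Matrix.trace_add, Complex.add_re, dotProduct_add,
        Matrix.mulVec_add]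
      ring
    · intro c A₁
      simp only [B, tcoef_smul, Matrix.trace_smul, Complex.real_smul, Complex.re_ofReal_mul,
        dotProduct_smul, Matrix.mulVec_smul, smul_eq_mul]
      ring
  have hsymm : ∀ A A', B A A' = B A' A := fun A A' => by
    have : tcoef A ⬝ᵥ S *ᵥ tcoef A' = tcoef A' ⬝ᵥ S *ᵥ tcoef A := by
      rw [Matrix.dotProduct_mulVec, ← Matrix.mulVec_transpose, hSs.eq, dotProduct_comm]
    simp only [B, this]
    ring
  have hB1 : ∀ A, IsLinearMap ℝ (fun A' => B A' A) := fun A => by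
    simpa only [hsymm _ A] using hB2 A
  have hBφ : ∀ φ, B (pmat φ) (pmat φ) = 0 := fun φ => by
    rw [← (hlin φ).2, r0_eq]
    simp only [B]
    ring
  have hp1 : ∀ u, pmat (fun a => ![u a, 0]) = Matrix.vecMulVec u (star u) := fun u => by
    ext a b
    simp [pmat, Matrix.mul_apply, Matrix.vecMulVec_apply]
  have hp2 : ∀ u v, pmat (fun a => ![u a, v a]) =
      Matrix.vecMulVec u (star u) + Matrix.vecMulVec v (star v) := fun u v => by
    ext a b
    simp [pmat, Matrix.mul_apply, Matrix.vecMulVec_apply]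
  have hBu : ∀ u v, B (Matrix.vecMulVec u (star u)) (Matrix.vecMulVec v (star v)) = 0 :=
    fun u v => by
      have h1 := hBφ (fun a => ![u a, 0])
      have h2 := hBφ (fun a => ![v a, 0])
      have h3 := hBφ (fun a => ![u a, v a])
      rw [hp1] at h1 h2
      rw [hp2, (hB2 _).map_add, (hB1 _).map_add, (hB1 _).map_add, h1, h2,
        hsymm (Matrix.vecMulVec v _)] at h3
      linarith
  have hB0 : ∀ A A', A.IsHermitian → A'.IsHermitian → B A A' = 0 := fun A A' hA hA' =>
    eq_zero_of_isLinearMap (hB2 A) (fun v => eq_zero_of_isLinearMap (hB1 _)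
      (fun u => hBu u v) hA) hA'
  have hm0 : ∀ A, A.IsHermitian → m ⬝ᵥ tcoef A = 0 := fun A hA => by
    refine eq_zero_of_isLinearMap (f := fun A => m ⬝ᵥ tcoef A) ⟨fun A₁ A₂ => ?_, fun c A₁ => ?_⟩
      (fun u => ?_) hA
    · rw [tcoef_add, dotProduct_add]
    · rw [tcoef_smul, dotProduct_smul]
    · rw [← hp1]
      exact (hlin _).1
  have htm : ∀ j, tcoef (tm j) = Pi.single j 2⁻¹ := fun j => by
    ext i
    have := tcoef_tm i j
    rw [Pi.single_apply]
    split_ifs at this ⊢ <;> linarith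
  refine ⟨sub_eq_zero.mp (show m = 0 from ?_), sub_eq_zero.mp (show l = 0 from ?_),
    sub_eq_zero.mp (show S = 0 from ?_)⟩
  · ext i
    have := hm0 _ (tm_isHermitian i)
    rw [htm, dotProduct_single] at this
    simpa using this
  · ext i
    have := hB0 1 _ Matrix.isHermitian_one (tm_isHermitian i)
    simpa [B, tcoef_one, trace_tm, htm] using this
  · ext i j
    have := hB0 _ _ (tm_isHermitian i) (tm_isHermitian j)
    simpa [B, trace_tm, htm] using this

lemma exists_perm_eq_of_roots {l : Fin 3 → ℝ} {α β : ℝ} (h : ∀ i, l i * l i = α + β * l i) :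
    ∃ σ : Equiv.Perm (Fin 3), l (σ 0) = l (σ 1) := by
  have h' : ∀ i j, l i = l j ∨ l i + l j = β := fun i j => by
    have : (l i - l j) * (l i + l j - β) = 0 := by linear_combination h i - h j
    rcases mul_eq_zero.mp this with h0 | h0
    · exact Or.inl (by linarith)
    · exact Or.inr (by linarith)
  rcases h' 0 1 with h01 | h01
  · exact ⟨1, h01⟩
  rcases h' 0 2 with h02 | h02
  · exact ⟨Equiv.swap 1 2, h02⟩
  · refine ⟨Equiv.swap 0 2, ?_⟩
    change l 2 = l 1
    linarith

lemma exists_unitary_diag {A : Matrix (Fin 3) (Fin 3) ℂ} (hA : A.IsHermitian) {α β : ℝ}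
    (h : A * A = α • 1 + β • A) :
    ∃ (U : Matrix (Fin 3) (Fin 3) ℂ) (a c : ℝ), U * Uᴴ = 1 ∧
      A = U * Matrix.diagonal ![(a : ℂ), (a : ℂ), (c : ℂ)] * Uᴴ := by
  set V : Matrix (Fin 3) (Fin 3) ℂ := ↑hA.eigenvectorUnitary with hV
  set l := hA.eigenvalues with hl
  have hVV : V * Vᴴ = 1 := Unitary.coe_mul_star_self hA.eigenvectorUnitary
  have hs : A = V * Matrix.diagonal (fun i => (l i : ℂ)) * Vᴴ := by
    conv_lhs => rw [hA.spectral_theorem, Unitary.conjStarAlgAut_apply]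
    rfl
  have hD : Vᴴ * A * V = Matrix.diagonal (fun i => (l i : ℂ)) := by
    rw [hs]
    simp only [mul_assoc, mul_eq_one_comm.mp hVV, mul_one]
    rw [← mul_assoc, mul_eq_one_comm.mp hVV, one_mul]
  have hDD : (Vᴴ * A * V) * (Vᴴ * A * V) = α • 1 + β • (Vᴴ * A * V) := by
    have : (Vᴴ * A * V) * (Vᴴ * A * V) = Vᴴ * (A * (V * Vᴴ) * A) * V := by
      simp only [mul_assoc]
    rw [this, hVV, mul_one, h, mul_add, add_mul, mul_smul_comm, mul_smul_comm, smul_mul_assoc,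
      smul_mul_assoc, mul_one, mul_eq_one_comm.mp hVV]
  have hroot : ∀ i, l i * l i = α + β * l i := fun i => by
    rw [hD] at hDD
    have := congrFun (congrFun hDD i) i
    simp [Matrix.add_apply, Matrix.smul_apply] at this
    exact_mod_cast this
  obtain ⟨σ, hσ⟩ := exists_perm_eq_of_roots hroot
  refine ⟨V.submatrix id σ, l (σ 0), l (σ 2), ?_, ?_⟩
  · rw [Matrix.conjTranspose_submatrix, Matrix.submatrix_mul_equiv, hVV]
    exact Matrix.submatrix_one_equiv (Equiv.refl _)
  · have hd : Matrix.diagonal ![(l (σ 0) : ℂ), (l (σ 0) : ℂ), (l (σ 2) : ℂ)] =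
        (Matrix.diagonal fun i => (l i : ℂ)).submatrix σ σ := by
      rw [Matrix.submatrix_diagonal_equiv]
      congr 1
      ext i
      fin_cases i <;> simp [hσ]
    rw [hd, Matrix.conjTranspose_submatrix, Matrix.submatrix_mul_equiv,
      Matrix.submatrix_mul_equiv, ← hs, Matrix.submatrix_id_id]

/-- Block antisymmetric matrices, the normal form of order-four CP transformations. -/
def cpNormal (s z : ℂ) : Matrix (Fin 3) (Fin 3) ℂ := !![0, s, 0; -s, 0, 0; 0, 0, z]

lemma cpNormal_mul_conjTranspose {s z : ℂ} (hs : s * (starRingEnd ℂ) s = 1)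
    (hz : z * (starRingEnd ℂ) z = 1) : cpNormal s z * (cpNormal s z)ᴴ = 1 := by
  ext a b
  fin_cases a <;> fin_cases b <;>
    simp [cpNormal, Matrix.mul_apply, Fin.sum_univ_three, hs, hz]

lemma cpNormal_mul_conj {s z : ℂ} (hs : s * (starRingEnd ℂ) s = 1)
    (hz : z * (starRingEnd ℂ) z = 1) :
    cpNormal s z * (cpNormal s z).map (starRingEnd ℂ) = Matrix.diagonal ![-1, -1, 1] := by
  ext a b
  fin_cases a <;> fin_cases b <;>
    simp [cpNormal, Matrix.mul_apply, Fin.sum_univ_three, hs, hz]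

lemma cpHom_cpNormal {s z : ℂ} (hs : s * (starRingEnd ℂ) s = 1)
    (hz : z * (starRingEnd ℂ) z = 1) (A : Matrix (Fin 3) (Fin 3) ℂ) :
    cpHom (cpNormal s z) (cpNormal_mul_conjTranspose hs hz) A =
      !![(starRingEnd ℂ) (A 1 1), -(starRingEnd ℂ) (A 1 0),
          (starRingEnd ℂ) (z * (starRingEnd ℂ) s) * (starRingEnd ℂ) (A 1 2);
        -(starRingEnd ℂ) (A 0 1), (starRingEnd ℂ) (A 0 0),
          -((starRingEnd ℂ) (z * (starRingEnd ℂ) s) * (starRingEnd ℂ) (A 0 2));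
        z * (starRingEnd ℂ) s * (starRingEnd ℂ) (A 2 1),
          -(z * (starRingEnd ℂ) s * (starRingEnd ℂ) (A 2 0)), (starRingEnd ℂ) (A 2 2)] := by
  rw [cpHom_apply]
  ext a b
  fin_cases a <;> fin_cases b <;>
    simp [cpNormal, Matrix.mul_apply, Matrix.vecMul, dotProduct, Fin.sum_univ_three] <;> grind

lemma cpNormal_conj_hmat {s z : ℂ} (hs : s * (starRingEnd ℂ) s = 1)
    (hz : z * (starRingEnd ℂ) z = 1) {x y : ℝ} (hx : (z * (starRingEnd ℂ) s).re = x)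
    (hy : (z * (starRingEnd ℂ) s).im = y) (v : Fin 8 → ℝ) :
    cpHom (cpNormal s z) (cpNormal_mul_conjTranspose hs hz) (hmat v) =
      hmat ![-v 0, -v 1, -v 2, x * v 5 + y * v 6, y * v 5 - x * v 6,
        -(x * v 3) - y * v 4, x * v 4 - y * v 3, v 7] := by
  have hw : z * (starRingEnd ℂ) s = ⟨x, y⟩ := Complex.ext hx hy
  rw [cpHom_cpNormal hs hz, hmat_eq, hmat_eq, hw]
  ext a b
  fin_cases a <;> fin_cases b <;> apply Complex.ext <;> simp <;> ring

lemma tcoef_anticommutator (v w : Fin 8 → ℝ) :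
    2 * tcoef (hmat v * hmat w + hmat w * hmat v) 0 =
        Real.sqrt 3 / 3 * (v 0 * w 7 + v 7 * w 0)
          + (v 3 * w 5 + v 5 * w 3 + v 4 * w 6 + v 6 * w 4) / 2 ∧
      2 * tcoef (hmat v * hmat w + hmat w * hmat v) 1 =
        Real.sqrt 3 / 3 * (v 1 * w 7 + v 7 * w 1)
          + (v 4 * w 5 + v 5 * w 4 - v 3 * w 6 - v 6 * w 3) / 2 ∧
      2 * tcoef (hmat v * hmat w + hmat w * hmat v) 2 =
        Real.sqrt 3 / 3 * (v 2 * w 7 + v 7 * w 2)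
          + (v 3 * w 3 + v 4 * w 4 - v 5 * w 5 - v 6 * w 6) / 2 := by
  rw [tcoef_eq, hmat_eq, hmat_eq]
  refine ⟨?_, ?_, ?_⟩ <;> simp <;> ring

lemma Kvec_apply {S : Matrix (Fin 8) (Fin 8) ℝ} (hS : S.IsSymm) {n : ℕ}
    (h : ∀ i : Fin 8, i ≠ 7 → (S ^ n) i 7 = 0) :
    Kvec S n 0 = (S ^ n) 3 5 + (S ^ n) 4 6 ∧ Kvec S n 1 = (S ^ n) 4 5 - (S ^ n) 3 6 ∧
      Kvec S n 2 = ((S ^ n) 3 3 + (S ^ n) 4 4 - (S ^ n) 5 5 - (S ^ n) 6 6) / 2 := by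
  have hT : ∀ i j, (S ^ n) i j = (S ^ n) j i := fun i j => (hS.pow n).apply j i
  simp only [Kvec]
  generalize S ^ n = T at *
  have key : ∀ (a b : Fin 8), T a b = ∑ j, ∑ k, (Pi.single j 1 : Fin 8 → ℝ) a *
      (Pi.single k 1 : Fin 8 → ℝ) b * T j k := fun a b => by
    simp [Pi.single_apply]
  have hd : ∀ i j k, dT i j k = 2 * tcoef (hmat (Pi.single j 1) * hmat (Pi.single k 1)
      + hmat (Pi.single k 1) * hmat (Pi.single j 1)) i := fun i j k => by
    rw [dT_eq, hmat_single, hmat_single]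
  have h7 : ∀ i : Fin 8, i ≠ 7 → T 7 i = 0 := fun i hi => by rw [hT, h i hi]
  have h0 : ∑ j, ∑ k, dT 0 j k * T j k =
      Real.sqrt 3 / 3 * (T 0 7 + T 7 0) + (T 3 5 + T 5 3 + T 4 6 + T 6 4) / 2 := by
    rw [key 0 7, key 7 0, key 3 5, key 5 3, key 4 6, key 6 4]
    simp only [← Finset.sum_add_distrib, Finset.sum_div, Finset.mul_sum]
    refine Finset.sum_congr rfl fun j _ => Finset.sum_congr rfl fun k _ => ?_
    rw [hd, (tcoef_anticommutator _ _).1]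
    ring
  have h1 : ∑ j, ∑ k, dT 1 j k * T j k =
      Real.sqrt 3 / 3 * (T 1 7 + T 7 1) + (T 4 5 + T 5 4 - T 3 6 - T 6 3) / 2 := by
    rw [key 1 7, key 7 1, key 4 5, key 5 4, key 3 6, key 6 3]
    simp only [← Finset.sum_add_distrib, ← Finset.sum_sub_distrib, Finset.sum_div,
      Finset.mul_sum]
    refine Finset.sum_congr rfl fun j _ => Finset.sum_congr rfl fun k _ => ?_
    rw [hd, (tcoef_anticommutator _ _).2.1]
    ring
  have h2 : ∑ j, ∑ k, dT 2 j k * T j k =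
      Real.sqrt 3 / 3 * (T 2 7 + T 7 2) + (T 3 3 + T 4 4 - T 5 5 - T 6 6) / 2 := by
    rw [key 2 7, key 7 2, key 3 3, key 4 4, key 5 5, key 6 6]
    simp only [← Finset.sum_add_distrib, ← Finset.sum_sub_distrib, Finset.sum_div,
      Finset.mul_sum]
    refine Finset.sum_congr rfl fun j _ => Finset.sum_congr rfl fun k _ => ?_
    rw [hd, (tcoef_anticommutator _ _).2.2]
    ring
  rw [h0, h1, h2, h 0 (by decide), h7 0 (by decide), h 1 (by decide), h7 1 (by decide),
    h 2 (by decide), h7 2 (by decide), hT 5 3, hT 6 4, hT 5 4, hT 6 3]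
  refine ⟨?_, ?_, ?_⟩ <;> ring

lemma map_conj_mul_transpose {U : Matrix (Fin 3) (Fin 3) ℂ} (hU : U * Uᴴ = 1) :
    U.map (starRingEnd ℂ) * Uᵀ = 1 := by
  have h := congrArg (fun A => A.map (starRingEnd ℂ)) hU
  simp only [Matrix.map_mul] at h
  have h1 : Uᴴ.map (starRingEnd ℂ) = Uᵀ := by ext; simp
  rw [h1] at h
  rw [h]
  simp

lemma eq_cpNormal {Y : Matrix (Fin 3) (Fin 3) ℂ} {a c : ℝ} (hY : Y * Yᴴ = 1)
    (h : Y * Y.map (starRingEnd ℂ) = Matrix.diagonal ![(a : ℂ), (a : ℂ), (c : ℂ)])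
    (ha : a * a = 1) (hc : c * c = 1) (hne : ¬(a = 1 ∧ c = 1)) :
    ∃ s z : ℂ, s * (starRingEnd ℂ) s = 1 ∧ z * (starRingEnd ℂ) z = 1 ∧ Y = cpNormal s z := by
  have h1 : Y.map (starRingEnd ℂ) = Yᴴ * Matrix.diagonal ![(a : ℂ), (a : ℂ), (c : ℂ)] := by
    rw [← h, ← mul_assoc, mul_eq_one_comm.mp hY, one_mul]
  have h2 : ∀ i j, Y i j = Y j i * (![a, a, c] j : ℝ) := fun i j => by
    have h3 := congrArg (starRingEnd ℂ) (congrFun (congrFun h1 i) j)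
    rw [Matrix.mul_diagonal] at h3
    simp only [Matrix.map_apply, Complex.conj_conj, Matrix.conjTranspose_apply, map_mul,
      RCLike.star_def] at h3
    rw [h3]
    fin_cases j <;> simp
  have hrow : ∀ i, ∑ k, Y i k * (starRingEnd ℂ) (Y i k) = 1 := fun i => by
    have := congrFun (congrFun hY i) i
    simpa [Matrix.mul_apply] using this
  have ha' : a = 1 ∨ a = -1 := mul_self_eq_one_iff.mp ha
  have hc' : c = 1 ∨ c = -1 := mul_self_eq_one_iff.mp hc
  have h00 := h2 0 0; have h11 := h2 1 1; have h22 := h2 2 2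
  have h01 := h2 0 1; have h10 := h2 1 0
  have h02 := h2 0 2; have h20 := h2 2 0
  have h12 := h2 1 2; have h21 := h2 2 1
  rcases ha' with rfl | rfl <;> rcases hc' with rfl | rfl <;>
    simp at h00 h11 h22 h01 h10 h02 h20 h12 h21
  · simp at hne
  · have e22 : Y 2 2 = 0 := by linear_combination h22 / 2
    have e20 : Y 2 0 = 0 := by linear_combination h20 / 2 + h02 / 2
    have e21 : Y 2 1 = 0 := by linear_combination h21 / 2 + h12 / 2
    have := hrow 2
    simp [Fin.sum_univ_three, e22, e20, e21] at this
  · have e00 : Y 0 0 = 0 := by linear_combination h00 / 2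
    have e11 : Y 1 1 = 0 := by linear_combination h11 / 2
    have e20 : Y 2 0 = 0 := by linear_combination h20 / 2 - h02 / 2
    have e21 : Y 2 1 = 0 := by linear_combination h21 / 2 - h12 / 2
    have e02 : Y 0 2 = 0 := by rw [h02, e20]
    have e12 : Y 1 2 = 0 := by rw [h12, e21]
    refine ⟨Y 0 1, Y 2 2, ?_, ?_, ?_⟩
    · simpa [Fin.sum_univ_three, e00, e02] using hrow 0
    · simpa [Fin.sum_univ_three, e20, e21] using hrow 2
    · ext i j
      fin_cases i <;> fin_cases j <;> simp [cpNormal, e00, e11, e20, e21, e02, e12, h10]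
  · have hdet : Y.det = 0 := by
      rw [Matrix.det_fin_three]
      grind
    have := congrArg Matrix.det hY
    rw [Matrix.det_mul, hdet] at this
    simp at this

lemma exists_cpNormal {X : Matrix (Fin 3) (Fin 3) ℂ} (hX : X * Xᴴ = 1)
    (hne : X * X.map (starRingEnd ℂ) ≠ 1) (hsq : (X * X.map (starRingEnd ℂ)) ^ 2 = 1) :
    ∃ U : Matrix (Fin 3) (Fin 3) ℂ, ∃ s z : ℂ, U * Uᴴ = 1 ∧ s * (starRingEnd ℂ) s = 1 ∧
      z * (starRingEnd ℂ) z = 1 ∧ X = U * cpNormal s z * Uᵀ := by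
  have hbar : X.map (starRingEnd ℂ) * Xᵀ = 1 := map_conj_mul_transpose hX
  set W := X * X.map (starRingEnd ℂ) with hW
  have hWH : Wᴴ = Xᵀ * Xᴴ := by
    rw [hW, Matrix.conjTranspose_mul]
    congr 1
    ext
    simp
  have hWW : W * Wᴴ = 1 := by
    rw [hWH, hW, mul_assoc, ← mul_assoc _ Xᵀ, hbar, one_mul, hX]
  have hherm : W.IsHermitian := by
    rw [Matrix.IsHermitian, ← one_mul Wᴴ, ← hsq, pow_two, mul_assoc, hWW, mul_one]
  obtain ⟨U, a, c, hU, hD⟩ := exists_unitary_diag (α := 1) (β := 0) hherm (by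
    rw [← pow_two, hsq]; simp)
  have hU' := mul_eq_one_comm.mp hU
  have hUb := map_conj_mul_transpose hU
  have hWD : Uᴴ * W * U = Matrix.diagonal ![(a : ℂ), (a : ℂ), (c : ℂ)] := by
    rw [hD]
    simp only [mul_assoc, hU', mul_one]
    rw [← mul_assoc, hU', one_mul]
  set Y := Uᴴ * X * U.map (starRingEnd ℂ) with hYdef
  have hXY : X = U * Y * Uᵀ := by
    have : U * Y * Uᵀ = (U * Uᴴ) * X * (U.map (starRingEnd ℂ) * Uᵀ) := by
      simp only [hYdef, mul_assoc]
    rw [this, hU, hUb, one_mul, mul_one]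
  have hYH : Yᴴ = Uᵀ * Xᴴ * U := by
    have : (U.map (starRingEnd ℂ))ᴴ = Uᵀ := by ext; simp
    rw [hYdef, Matrix.conjTranspose_mul, Matrix.conjTranspose_mul, this,
      Matrix.conjTranspose_conjTranspose, mul_assoc]
  have hY : Y * Yᴴ = 1 := by
    have : Y * Yᴴ = Uᴴ * (X * (U.map (starRingEnd ℂ) * Uᵀ) * Xᴴ) * U := by
      rw [hYH, hYdef]
      simp only [mul_assoc]
    rw [this, hUb, mul_one, hX, mul_one, hU']
  have hYc : Y.map (starRingEnd ℂ) = Uᵀ * X.map (starRingEnd ℂ) * U := by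
    have h1 : Uᴴ.map (starRingEnd ℂ) = Uᵀ := by ext; simp
    have h2 : (U.map (starRingEnd ℂ)).map (starRingEnd ℂ) = U := by ext; simp
    rw [hYdef, Matrix.map_mul, Matrix.map_mul, h1, h2]
  have hYD : Y * Y.map (starRingEnd ℂ) = Matrix.diagonal ![(a : ℂ), (a : ℂ), (c : ℂ)] := by
    have : Y * Y.map (starRingEnd ℂ) =
        Uᴴ * (X * (U.map (starRingEnd ℂ) * Uᵀ) * X.map (starRingEnd ℂ)) * U := by
      rw [hYc, hYdef]
      simp only [mul_assoc]
    rw [this, hUb, mul_one, ← hW, hWD]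
  have hDD : Matrix.diagonal ![(a : ℂ), (a : ℂ), (c : ℂ)] *
      Matrix.diagonal ![(a : ℂ), (a : ℂ), (c : ℂ)] = 1 := by
    have : (Uᴴ * W * U) * (Uᴴ * W * U) = Uᴴ * (W * (U * Uᴴ) * W) * U := by
      simp only [mul_assoc]
    rw [← hWD, this, hU, mul_one, ← pow_two, hsq, mul_one, hU']
  have hroot : ∀ i, ((![a, a, c] i * ![a, a, c] i : ℝ)) = 1 := fun i => by
    have := congrFun (congrFun hDD i) i
    rw [Matrix.diagonal_mul_diagonal, Matrix.diagonal_apply_eq, Matrix.one_apply_eq] at this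
    fin_cases i <;> simp at this ⊢ <;> exact_mod_cast this
  obtain ⟨s, z, hs, hz, hYs⟩ := eq_cpNormal hY hYD (hroot 0) (hroot 2) (by
    rintro ⟨rfl, rfl⟩
    apply hne
    have h1 : Matrix.diagonal ![((1 : ℝ) : ℂ), ((1 : ℝ) : ℂ), ((1 : ℝ) : ℂ)] = 1 := by
      ext i j
      fin_cases i <;> fin_cases j <;> simp
    rw [hD, h1, mul_one, hU])
  exact ⟨U, s, z, hU, hs, hz, by rw [← hYs]; exact hXY⟩

lemma adHom_conjTranspose_comp {U : Matrix (Fin 3) (Fin 3) ℂ} (hU : U * Uᴴ = 1)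
    (hU' : Uᴴ * Uᴴᴴ = 1) : rot (adHom Uᴴ hU') = (rot (adHom U hU))ᵀ := by
  have h : rot (adHom Uᴴ hU') * rot (adHom U hU) = 1 := by
    rw [← rot_comp (trace_adHom hU')]
    refine rot_eq_one fun A => ?_
    rw [StarAlgHom.comp_apply, adHom_apply, adHom_apply, Matrix.conjTranspose_conjTranspose]
    have : Uᴴ * (U * A * Uᴴ) * U = (Uᴴ * U) * A * (Uᴴ * U) := by simp only [mul_assoc]
    rw [this, mul_eq_one_comm.mp hU, one_mul, mul_one]
  rw [← mul_one (rot (adHom Uᴴ hU')), ← rot_mul_rot_transpose (trace_adHom hU), ← mul_assoc, h,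
    one_mul]

lemma rot_cpHom_congr {U Y X : Matrix (Fin 3) (Fin 3) ℂ} (hU : U * Uᴴ = 1) (hY : Y * Yᴴ = 1)
    (hX : X * Xᴴ = 1) (h : X = U * Y * Uᵀ) :
    rot (cpHom X hX) = rot (adHom U hU) * rot (cpHom Y hY) * (rot (adHom U hU))ᵀ := by
  have hU' : Uᴴ * Uᴴᴴ = 1 := by
    rw [Matrix.conjTranspose_conjTranspose, mul_eq_one_comm.mp hU]
  rw [← adHom_conjTranspose_comp hU hU', ← rot_comp (trace_adHom hU),
    ← rot_comp (fun A => by rw [StarAlgHom.comp_apply, trace_adHom hU, trace_cpHom hY])]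
  congr 1
  refine StarAlgHom.ext fun A => ?_
  have h1 : Xᴴ = U.map (starRingEnd ℂ) * Yᴴ * Uᴴ := by
    have : (Uᵀ)ᴴ = U.map (starRingEnd ℂ) := by ext; simp
    rw [h, Matrix.conjTranspose_mul, Matrix.conjTranspose_mul, this, mul_assoc]
  have h2 : (Uᴴ * A * Uᴴᴴ).map (starRingEnd ℂ) =
      Uᵀ * A.map (starRingEnd ℂ) * U.map (starRingEnd ℂ) := by
    have : Uᴴ.map (starRingEnd ℂ) = Uᵀ := by ext; simp
    rw [Matrix.map_mul, Matrix.map_mul, this, Matrix.conjTranspose_conjTranspose]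
  rw [StarAlgHom.comp_apply, StarAlgHom.comp_apply, cpHom_apply, cpHom_apply, adHom_apply,
    adHom_apply, h1, h2, h]
  simp only [mul_assoc]

lemma isSymm_conj {n : Type*} [Fintype n] {S : Matrix n n ℝ} (hS : S.IsSymm) (R : Matrix n n ℝ) :
    (R * S * Rᵀ).IsSymm := by
  rw [Matrix.IsSymm, Matrix.transpose_mul, Matrix.transpose_mul, Matrix.transpose_transpose,
    hS.eq, mul_assoc]

lemma transpose_mulVec_eq_iff {R : Matrix (Fin 8) (Fin 8) ℝ} (hR : Rᵀ * R = 1)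
    {v w : Fin 8 → ℝ} : Rᵀ *ᵥ v = w ↔ R *ᵥ w = v := by
  constructor
  · rintro rfl
    rw [Matrix.mulVec_mulVec, mul_eq_one_comm.mp hR, Matrix.one_mulVec]
  · rintro rfl
    rw [Matrix.mulVec_mulVec, hR, Matrix.one_mulVec]

lemma transpose_mul_mul_eq_iff {R S : Matrix (Fin 8) (Fin 8) ℝ} (hR : Rᵀ * R = 1) :
    Rᵀ * S * R = S ↔ R * S = S * R := by
  constructor
  · intro h
    conv_lhs => rw [← h]
    rw [← mul_assoc, ← mul_assoc, mul_eq_one_comm.mp hR, one_mul]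
  · intro h
    rw [mul_assoc, ← h, ← mul_assoc, hR, one_mul]

lemma hasCP4_iff (M0 Λ0 : ℝ) (M L : Fin 8 → ℝ) {Λ : Matrix (Fin 8) (Fin 8) ℝ}
    (hΛ : Λ.IsSymm) :
    HasCP4 M0 Λ0 M L Λ ↔ ∃ (X : Matrix (Fin 3) (Fin 3) ℂ) (hX : X * Xᴴ = 1),
      X * X.map (starRingEnd ℂ) ≠ 1 ∧ (X * X.map (starRingEnd ℂ)) ^ 2 = 1 ∧
      rot (cpHom X hX) *ᵥ M = M ∧ rot (cpHom X hX) *ᵥ L = L ∧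
      rot (cpHom X hX) * Λ = Λ * rot (cpHom X hX) := by
  have key : ∀ (X : Matrix (Fin 3) (Fin 3) ℂ) (hX : X * Xᴴ = 1),
      (∀ φ, pot M0 Λ0 M L Λ (fun a α => ∑ b, X a b * (starRingEnd ℂ) (φ b α)) =
        pot M0 Λ0 M L Λ φ) ↔ rot (cpHom X hX) *ᵥ M = M ∧ rot (cpHom X hX) *ᵥ L = L ∧
      rot (cpHom X hX) * Λ = Λ * rot (cpHom X hX) := fun X hX => by
    have hR := rot_transpose_mul_rot (trace_cpHom hX)
    have hs := isSymm_conj hΛ (rot (cpHom X hX))ᵀ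
    rw [Matrix.transpose_transpose] at hs
    simp only [pot_cp M0 Λ0 M L Λ hX]
    rw [pot_eq_iff M0 Λ0 M _ L _ hΛ hs, transpose_mulVec_eq_iff hR, transpose_mulVec_eq_iff hR,
      transpose_mul_mul_eq_iff hR]
  constructor
  · rintro ⟨X, hX, h1, h2, h3⟩
    exact ⟨X, hX, h1, h2, (key X hX).mp h3⟩
  · rintro ⟨X, hX, h1, h2, h3⟩
    exact ⟨X, hX, h1, h2, (key X hX).mpr h3⟩

/-- The rotation of `ℝ⁸` induced by the normal form `cpNormal s z`. -/
def cpRot {s z : ℂ} (hs : s * (starRingEnd ℂ) s = 1) (hz : z * (starRingEnd ℂ) z = 1) :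
    Matrix (Fin 8) (Fin 8) ℝ :=
  rot (cpHom (cpNormal s z) (cpNormal_mul_conjTranspose hs hz))

lemma hasCP4_iff_normal (M0 Λ0 : ℝ) (M L : Fin 8 → ℝ) {Λ : Matrix (Fin 8) (Fin 8) ℝ}
    (hΛ : Λ.IsSymm) :
    HasCP4 M0 Λ0 M L Λ ↔ ∃ (U : Matrix (Fin 3) (Fin 3) ℂ) (hU : U * Uᴴ = 1) (s z : ℂ)
      (hs : s * (starRingEnd ℂ) s = 1) (hz : z * (starRingEnd ℂ) z = 1),
      cpRot hs hz *ᵥ ((rot (adHom U hU))ᵀ *ᵥ M) = (rot (adHom U hU))ᵀ *ᵥ M ∧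
      cpRot hs hz *ᵥ ((rot (adHom U hU))ᵀ *ᵥ L) = (rot (adHom U hU))ᵀ *ᵥ L ∧
      cpRot hs hz * ((rot (adHom U hU))ᵀ * Λ * rot (adHom U hU)) =
        (rot (adHom U hU))ᵀ * Λ * rot (adHom U hU) * cpRot hs hz := by
  have key : ∀ {U X : Matrix (Fin 3) (Fin 3) ℂ} (hU : U * Uᴴ = 1) (hX : X * Xᴴ = 1) {s z : ℂ}
      (hs : s * (starRingEnd ℂ) s = 1) (hz : z * (starRingEnd ℂ) z = 1)
      (_ : X = U * cpNormal s z * Uᵀ),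
      (rot (cpHom X hX) *ᵥ M = M ∧ rot (cpHom X hX) *ᵥ L = L ∧
        rot (cpHom X hX) * Λ = Λ * rot (cpHom X hX)) ↔
      (cpRot hs hz *ᵥ ((rot (adHom U hU))ᵀ *ᵥ M) = (rot (adHom U hU))ᵀ *ᵥ M ∧
      cpRot hs hz *ᵥ ((rot (adHom U hU))ᵀ *ᵥ L) = (rot (adHom U hU))ᵀ *ᵥ L ∧
      cpRot hs hz * ((rot (adHom U hU))ᵀ * Λ * rot (adHom U hU)) =
        (rot (adHom U hU))ᵀ * Λ * rot (adHom U hU) * cpRot hs hz) := by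
    intro U X hU hX s z hs hz h
    have hO := rot_transpose_mul_rot (trace_adHom hU)
    have hO' := rot_mul_rot_transpose (trace_adHom hU)
    have hXR : rot (cpHom X hX) = rot (adHom U hU) * cpRot hs hz * (rot (adHom U hU))ᵀ :=
      rot_cpHom_congr hU (cpNormal_mul_conjTranspose hs hz) hX h
    rw [hXR]
    set O := rot (adHom U hU)
    set R := cpRot hs hz
    have hv : ∀ v, (O * R * Oᵀ) *ᵥ v = v ↔ R *ᵥ (Oᵀ *ᵥ v) = Oᵀ *ᵥ v := fun v => by
      rw [eq_comm (b := Oᵀ *ᵥ v), transpose_mulVec_eq_iff hO, Matrix.mulVec_mulVec,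
        Matrix.mulVec_mulVec, mul_assoc]
    have hS : (O * R * Oᵀ) * Λ = Λ * (O * R * Oᵀ) ↔ R * (Oᵀ * Λ * O) = Oᵀ * Λ * O * R := by
      have e1 : R * (Oᵀ * Λ * O) = Oᵀ * ((O * R * Oᵀ) * Λ) * O := by
        simp only [← mul_assoc, hO, one_mul]
      have e2 : Oᵀ * Λ * O * R = Oᵀ * (Λ * (O * R * Oᵀ)) * O := by
        simp only [mul_assoc, hO, mul_one]
      rw [e1, e2]
      refine ⟨fun h => by rw [h], fun h => ?_⟩
      have := congrArg (fun A => O * A * Oᵀ) h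
      simpa only [mul_assoc, hO', mul_one, ← mul_assoc O Oᵀ, one_mul] using this
    rw [hv, hv, hS]
  rw [hasCP4_iff M0 Λ0 M L hΛ]
  constructor
  · rintro ⟨X, hX, hne, hsq, h⟩
    obtain ⟨U, s, z, hU, hs, hz, hXU⟩ := exists_cpNormal hX hne hsq
    exact ⟨U, hU, s, z, hs, hz, (key hU hX hs hz hXU).mp h⟩
  · rintro ⟨U, hU, s, z, hs, hz, h⟩
    have hU' := mul_eq_one_comm.mp hU
    have hUt : Uᵀ * U.map (starRingEnd ℂ) = 1 := mul_eq_one_comm.mp (map_conj_mul_transpose hU)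
    have hXX : U * cpNormal s z * Uᵀ * (U * cpNormal s z * Uᵀ).map (starRingEnd ℂ) =
        U * Matrix.diagonal ![-1, -1, 1] * Uᴴ := by
      have : Uᵀ.map (starRingEnd ℂ) = Uᴴ := rfl
      have e : U * cpNormal s z * Uᵀ * (U * cpNormal s z * Uᵀ).map (starRingEnd ℂ) =
          U * (cpNormal s z * (Uᵀ * U.map (starRingEnd ℂ)) *
            (cpNormal s z).map (starRingEnd ℂ)) * Uᴴ := by
        rw [Matrix.map_mul, Matrix.map_mul, this]
        simp only [mul_assoc]
      rw [e, hUt, mul_one, cpNormal_mul_conj hs hz]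
    have hX : U * cpNormal s z * Uᵀ * (U * cpNormal s z * Uᵀ)ᴴ = 1 := by
      have : (Uᵀ)ᴴ = U.map (starRingEnd ℂ) := by ext; simp
      have e : U * cpNormal s z * Uᵀ * (U * cpNormal s z * Uᵀ)ᴴ =
          U * (cpNormal s z * (Uᵀ * U.map (starRingEnd ℂ)) * (cpNormal s z)ᴴ) * Uᴴ := by
        rw [Matrix.conjTranspose_mul, Matrix.conjTranspose_mul, this]
        simp only [mul_assoc]
      rw [e, hUt, mul_one, cpNormal_mul_conjTranspose hs hz, mul_one, hU]
    refine ⟨_, hX, ?_, ?_, (key hU hX hs hz rfl).mpr h⟩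
    · rw [hXX]
      intro h1
      have h2 := congrArg (fun A => Uᴴ * A * U) h1
      simp only [mul_assoc, hU', mul_one] at h2
      rw [← mul_assoc, hU', one_mul] at h2
      have := congrFun (congrFun h2 0) 0
      simp at this
      norm_num at this
    · rw [hXX, pow_two]
      have e : U * Matrix.diagonal ![-1, -1, 1] * Uᴴ * (U * Matrix.diagonal ![-1, -1, 1] * Uᴴ) =
          U * (Matrix.diagonal ![-1, -1, 1] * (Uᴴ * U) * Matrix.diagonal ![-1, -1, 1]) * Uᴴ := by
        simp only [mul_assoc]
      have hd : Matrix.diagonal ![(-1 : ℂ), -1, 1] * Matrix.diagonal ![-1, -1, 1] = 1 := by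
        ext i j
        fin_cases i <;> fin_cases j <;> simp
      rw [e, hU', mul_one, hd, mul_one, hU]

/-- The basis-invariant conditions for a CP symmetry of order four, with a specified
self-aligned eigenvector. -/
def InvariantConditions (v8 M L : Fin 8 → ℝ) (Λ : Matrix (Fin 8) (Fin 8) ℝ) : Prop :=
  (∑ i, v8 i ^ 2 = 1) ∧ (∃ μ : ℝ, Λ.mulVec v8 = μ • v8) ∧ SelfAligned v8 ∧
    (∃ v1 v2 v3 : Fin 8 → ℝ,
      (v1 ≠ 0 ∧ ∃ μ : ℝ, Λ.mulVec v1 = μ • v1) ∧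
      (v2 ≠ 0 ∧ ∃ μ : ℝ, Λ.mulVec v2 = μ • v2) ∧
      (v3 ≠ 0 ∧ ∃ μ : ℝ, Λ.mulVec v3 = μ • v3) ∧
      (∑ i, v1 i * v2 i = 0) ∧ (∑ i, v1 i * v3 i = 0) ∧ (∑ i, v2 i * v3 i = 0) ∧
      (∑ i, v1 i * v8 i = 0) ∧ (∑ i, v2 i * v8 i = 0) ∧ (∑ i, v3 i * v8 i = 0) ∧
      FOrth v8 v1 ∧ FOrth v8 v2 ∧ FOrth v8 v3) ∧
    (∃ c : ℝ, M = c • v8) ∧ (∃ c : ℝ, L = c • v8) ∧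
    (∃ c : ℝ, Kvec Λ 1 = c • v8) ∧ (∃ c : ℝ, Kvec Λ 2 = c • v8)

lemma InvariantConditions.map
    {θ : Matrix (Fin 3) (Fin 3) ℂ →⋆ₐ[ℝ] Matrix (Fin 3) (Fin 3) ℂ}
    (hθ : ∀ A, (θ A).trace.re = A.trace.re) {v8 M L : Fin 8 → ℝ}
    {Λ : Matrix (Fin 8) (Fin 8) ℝ} (h : InvariantConditions v8 M L Λ) :
    InvariantConditions (rot θ *ᵥ v8) (rot θ *ᵥ M) (rot θ *ᵥ L) (rot θ * Λ * (rot θ)ᵀ) := by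
  obtain ⟨h8, he, hs, ⟨v1, v2, v3, ⟨h1, e1⟩, ⟨h2, e2⟩, ⟨h3, e3⟩, h12, h13, h23, h18, h28, h38,
    f1, f2, f3⟩, hM, hL, hK1, hK2⟩ := h
  have hR := rot_transpose_mul_rot hθ
  have hdot : ∀ v w, (rot θ *ᵥ v) ⬝ᵥ (rot θ *ᵥ w) = v ⬝ᵥ w := fun v w => by
    rw [Matrix.dotProduct_mulVec, ← Matrix.mulVec_transpose, Matrix.mulVec_mulVec, hR,
      Matrix.one_mulVec]
  have heig : ∀ v : Fin 8 → ℝ, (∃ μ : ℝ, Λ *ᵥ v = μ • v) →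
      ∃ μ : ℝ, (rot θ * Λ * (rot θ)ᵀ) *ᵥ (rot θ *ᵥ v) = μ • (rot θ *ᵥ v) := by
    rintro v ⟨μ, hμ⟩
    refine ⟨μ, ?_⟩
    rw [Matrix.mulVec_mulVec, mul_assoc, hR, mul_one, ← Matrix.mulVec_mulVec, hμ,
      Matrix.mulVec_smul]
  have hne : ∀ v : Fin 8 → ℝ, v ≠ 0 → rot θ *ᵥ v ≠ 0 := fun v hv h0 => hv (by
    rw [← dotProduct_self_eq_zero, ← hdot, h0, dotProduct_zero])
  have hf : ∀ v, FOrth v8 v → FOrth (rot θ *ᵥ v8) (rot θ *ᵥ v) := fun v hv => by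
    rw [fOrth_iff] at hv ⊢
    rw [← map_hmat hθ, ← map_hmat hθ, ← map_mul, hv, map_mul]
  have hmul : ∀ v : Fin 8 → ℝ, (∃ c : ℝ, v = c • v8) → ∃ c : ℝ, rot θ *ᵥ v = c • (rot θ *ᵥ v8) := by
    rintro v ⟨c, rfl⟩
    exact ⟨c, Matrix.mulVec_smul _ _ _⟩
  refine ⟨?_, heig _ he, ?_, ⟨rot θ *ᵥ v1, rot θ *ᵥ v2, rot θ *ᵥ v3, ⟨hne _ h1, heig _ e1⟩,
    ⟨hne _ h2, heig _ e2⟩, ⟨hne _ h3, heig _ e3⟩, (hdot _ _).trans h12, (hdot _ _).trans h13,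
    (hdot _ _).trans h23, (hdot _ _).trans h18, (hdot _ _).trans h28, (hdot _ _).trans h38,
    hf _ f1, hf _ f2, hf _ f3⟩, hmul _ hM, hmul _ hL, ?_, ?_⟩
  · simp only [pow_two] at h8 ⊢
    exact (hdot _ _).trans h8
  · rw [selfAligned_iff] at hs ⊢
    obtain ⟨α, β, hs⟩ := hs
    refine ⟨α, β, ?_⟩
    rw [← map_hmat hθ, ← map_mul, hs, map_add, map_smul, map_smul, map_one]
  · rw [Kvec_conj hθ]
    exact hmul _ hK1
  · rw [Kvec_conj hθ]
    exact hmul _ hK2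

lemma cpRot_mulVec {s z : ℂ} (hs : s * (starRingEnd ℂ) s = 1) (hz : z * (starRingEnd ℂ) z = 1)
    {x y : ℝ} (hx : (z * (starRingEnd ℂ) s).re = x) (hy : (z * (starRingEnd ℂ) s).im = y)
    (v : Fin 8 → ℝ) :
    cpRot hs hz *ᵥ v = ![-v 0, -v 1, -v 2, x * v 5 + y * v 6, y * v 5 - x * v 6,
        -(x * v 3) - y * v 4, x * v 4 - y * v 3, v 7] :=
  hmat_injective (by
    rw [← cpNormal_conj_hmat hs hz hx hy, cpRot, map_hmat (trace_cpHom _)])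

lemma exists_cpRot_mulVec {s z : ℂ} (hs : s * (starRingEnd ℂ) s = 1)
    (hz : z * (starRingEnd ℂ) z = 1) : ∃ x y : ℝ, x * x + y * y = 1 ∧ ∀ v,
      cpRot hs hz *ᵥ v = ![-v 0, -v 1, -v 2, x * v 5 + y * v 6, y * v 5 - x * v 6,
        -(x * v 3) - y * v 4, x * v 4 - y * v 3, v 7] := by
  refine ⟨_, _, ?_, cpRot_mulVec hs hz rfl rfl⟩
  have h : Complex.normSq (z * (starRingEnd ℂ) s) = 1 := by
    rw [Complex.mul_conj] at hs hz
    rw [Complex.normSq_mul, Complex.normSq_conj, Complex.ofReal_eq_one.mp hs,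
      Complex.ofReal_eq_one.mp hz, one_mul]
  rwa [Complex.normSq_apply] at h

lemma eq_smul_single_of_cpRot_mulVec {s z : ℂ} {hs : s * (starRingEnd ℂ) s = 1}
    {hz : z * (starRingEnd ℂ) z = 1} {v : Fin 8 → ℝ} (h : cpRot hs hz *ᵥ v = v) :
    v = v 7 • Pi.single 7 1 := by
  obtain ⟨x, y, hxy, hR⟩ := exists_cpRot_mulVec hs hz
  rw [hR] at h
  have h0 := congrFun h 0; have h1 := congrFun h 1; have h2 := congrFun h 2
  have h3 := congrFun h 3; have h4 := congrFun h 4; have h5 := congrFun h 5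
  have h6 := congrFun h 6
  simp at h0 h1 h2 h3 h4 h5 h6
  ext i
  fin_cases i <;> simp <;> grind

lemma eq_zero_of_cpRot_mulVec {s z : ℂ} {hs : s * (starRingEnd ℂ) s = 1}
    {hz : z * (starRingEnd ℂ) z = 1} {v : Fin 8 → ℝ} (h : cpRot hs hz *ᵥ v = -v) :
    ∀ i, 3 ≤ i → v i = 0 := by
  obtain ⟨x, y, hxy, hR⟩ := exists_cpRot_mulVec hs hz
  rw [hR] at h
  have h3 := congrFun h 3; have h4 := congrFun h 4; have h5 := congrFun h 5
  have h6 := congrFun h 6; have h7 := congrFun h 7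
  simp at h3 h4 h5 h6 h7
  intro i hi
  fin_cases i <;> simp at hi ⊢ <;> grind

lemma fOrth_single_seven (a b c : ℝ) : FOrth (Pi.single 7 1) ![a, b, c, 0, 0, 0, 0, 0] := by
  rw [fOrth_iff, hmat_eq, hmat_eq]
  ext i j
  fin_cases i <;> fin_cases j <;> apply Complex.ext <;> simp <;> ring

lemma selfAligned_single_seven : SelfAligned (Pi.single 7 1) := by
  have h3 := sqrt_three_mul_self
  rw [selfAligned_iff, hmat_eq]
  refine ⟨1 / 6, -(Real.sqrt 3 / 6), ?_⟩
  ext i j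
  fin_cases i <;> fin_cases j <;> apply Complex.ext <;>
    simp [Matrix.add_apply, Matrix.smul_apply] <;> grind

lemma invariantConditions_of_cpRot {s z : ℂ} {hs : s * (starRingEnd ℂ) s = 1}
    {hz : z * (starRingEnd ℂ) z = 1} {M L : Fin 8 → ℝ} {Λ : Matrix (Fin 8) (Fin 8) ℝ}
    (hΛ : Λ.IsSymm) (hM : cpRot hs hz *ᵥ M = M) (hL : cpRot hs hz *ᵥ L = L)
    (hcomm : cpRot hs hz * Λ = Λ * cpRot hs hz) :
    InvariantConditions (Pi.single 7 1) M L Λ := by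
  have hθ := trace_cpHom (cpNormal_mul_conjTranspose hs hz)
  obtain ⟨x, y, -, hR⟩ := exists_cpRot_mulVec hs hz
  have hK : ∀ n, ∃ c : ℝ, Kvec Λ n = c • Pi.single 7 1 := fun n => by
    refine ⟨_, eq_smul_single_of_cpRot_mulVec (hs := hs) (hz := hz) ?_⟩
    have h : Kvec (cpRot hs hz * Λ * (cpRot hs hz)ᵀ) n = cpRot hs hz *ᵥ Kvec Λ n :=
      Kvec_conj hθ Λ n
    rw [hcomm, mul_assoc, cpRot, rot_mul_rot_transpose hθ, mul_one] at h
    exact h.symm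
  have hcol : ∀ i : Fin 8, i < 3 → ∀ a : Fin 8, 3 ≤ a → Λ a i = 0 := fun i hi a ha => by
    have h1 : cpRot hs hz *ᵥ Pi.single i 1 = -Pi.single i 1 := by
      rw [hR]
      ext a
      fin_cases i <;> simp at hi <;> fin_cases a <;> simp
    have h2 : cpRot hs hz *ᵥ (Λ *ᵥ Pi.single i 1) = -(Λ *ᵥ Pi.single i 1) := by
      rw [Matrix.mulVec_mulVec, hcomm, ← Matrix.mulVec_mulVec, h1, Matrix.mulVec_neg]
    have := eq_zero_of_cpRot_mulVec h2 a ha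
    simpa using this
  have h7 : cpRot hs hz *ᵥ Pi.single 7 1 = Pi.single 7 1 := by
    rw [hR]
    ext a
    fin_cases a <;> simp
  have hB : (Λ.submatrix ![0, 1, 2] ![0, 1, 2]).IsHermitian :=
    Matrix.IsHermitian.ext fun i j => by
      rw [Matrix.submatrix_apply, hΛ.apply, Matrix.submatrix_apply, star_trivial]
  set u : Fin 3 → Fin 3 → ℝ := fun k => (hB.eigenvectorBasis k).ofLp with hu
  have hdot : ∀ k l, u k ⬝ᵥ u l = if k = l then 1 else 0 := fun k l => by
    have := orthonormal_iff_ite.mp hB.eigenvectorBasis.orthonormal l k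
    rw [EuclideanSpace.inner_eq_star_dotProduct] at this
    simpa [eq_comm, hu] using this
  have hv : ∀ k, (![u k 0, u k 1, u k 2, 0, 0, 0, 0, 0] : Fin 8 → ℝ) ≠ 0 ∧
      ∃ μ : ℝ, Λ *ᵥ ![u k 0, u k 1, u k 2, 0, 0, 0, 0, 0] =
        μ • ![u k 0, u k 1, u k 2, 0, 0, 0, 0, 0] := fun k => by
    constructor
    · intro h
      have h0 := congrFun h 0; have h1 := congrFun h 1; have h2 := congrFun h 2
      simp at h0 h1 h2
      have := hdot k k
      simp [dotProduct, Fin.sum_univ_three, h0, h1, h2] at this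
    · refine ⟨hB.eigenvalues k, ?_⟩
      have he := hB.mulVec_eigenvectorBasis k
      have e0 := congrFun he 0; have e1 := congrFun he 1; have e2 := congrFun he 2
      simp [Matrix.mulVec, dotProduct, Fin.sum_univ_three] at e0 e1 e2
      ext i
      fin_cases i <;> simp [Matrix.mulVec, dotProduct, Fin.sum_univ_eight, hcol, hu, e0, e1, e2]
  have hvv : ∀ k l, k ≠ l → ∑ i, (![u k 0, u k 1, u k 2, 0, 0, 0, 0, 0] : Fin 8 → ℝ) i *
      (![u l 0, u l 1, u l 2, 0, 0, 0, 0, 0] : Fin 8 → ℝ) i = 0 := fun k l hkl => by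
    have := hdot k l
    rw [if_neg hkl] at this
    simpa [Fin.sum_univ_eight, dotProduct, Fin.sum_univ_three] using this
  have hv8 : ∀ k, ∑ i, (![u k 0, u k 1, u k 2, 0, 0, 0, 0, 0] : Fin 8 → ℝ) i *
      (Pi.single 7 1 : Fin 8 → ℝ) i = 0 := fun k => by
    simp [Fin.sum_univ_eight]
  refine ⟨by simp [Fin.sum_univ_eight],
    ⟨_, eq_smul_single_of_cpRot_mulVec (hs := hs) (hz := hz) ?_⟩,
    selfAligned_single_seven, ⟨_, _, _, hv 0, hv 1, hv 2, hvv 0 1 (by decide), hvv 0 2 (by decide),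
    hvv 1 2 (by decide), hv8 0, hv8 1, hv8 2, fOrth_single_seven _ _ _, fOrth_single_seven _ _ _,
    fOrth_single_seven _ _ _⟩, ⟨_, eq_smul_single_of_cpRot_mulVec hM⟩,
    ⟨_, eq_smul_single_of_cpRot_mulVec hL⟩, hK 1, hK 2⟩
  rw [Matrix.mulVec_mulVec, hcomm, ← Matrix.mulVec_mulVec, h7]

lemma exists_unit_relation {u w : Fin 3 → ℝ} (h : ∀ i j, u i * w j = u j * w i) :
    ∃ x y : ℝ, x * x + y * y = 1 ∧ ∀ i, x * u i + y * w i = 0 := by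
  by_cases h0 : ∀ i, u i = 0 ∧ w i = 0
  · exact ⟨1, 0, by norm_num, fun i => by simp [h0 i]⟩
  · obtain ⟨i, hi⟩ := not_forall.mp h0
    have hpos : 0 < u i * u i + w i * w i := by
      by_contra hn
      exact hi ⟨mul_self_eq_zero.mp (by nlinarith [mul_self_nonneg (u i), mul_self_nonneg (w i)]),
        mul_self_eq_zero.mp (by nlinarith [mul_self_nonneg (u i), mul_self_nonneg (w i)])⟩
    set r := Real.sqrt (u i * u i + w i * w i) with hr
    have hrr : r * r = u i * u i + w i * w i := Real.mul_self_sqrt hpos.le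
    have hr0 : r ≠ 0 := (Real.sqrt_pos.mpr hpos).ne'
    refine ⟨w i / r, -u i / r, ?_, fun j => ?_⟩
    · field_simp
      linarith
    · field_simp
      linarith [h i j]

lemma apply_eq_zero_of_fOrth {v w : Fin 8 → ℝ} (hv : ∀ i, i ≠ 7 → v i = 0) (hv7 : v 7 ≠ 0)
    (hdot : ∑ i, w i * v i = 0) (hf : FOrth v w) : ∀ i, 3 ≤ i → w i = 0 := by
  have h3 : Real.sqrt 3 ≠ 0 := by positivity
  have hw7 : w 7 = 0 := by
    simpa [Fin.sum_univ_eight, hv, hv7] using hdot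
  have hc : Real.sqrt 3 * v 7 ≠ 0 := mul_ne_zero h3 hv7
  rw [fOrth_iff, hmat_eq, hmat_eq] at hf
  have h02 := congrFun (congrFun hf 0) 2
  have h12 := congrFun (congrFun hf 1) 2
  have e3 := congrArg Complex.re h02
  have e4 := congrArg Complex.im h02
  have e5 := congrArg Complex.re h12
  have e6 := congrArg Complex.im h12
  simp [hv] at e3 e4 e5 e6
  intro i hi
  fin_cases i <;> simp at hi ⊢
  · exact (mul_eq_zero.mp (show Real.sqrt 3 * v 7 * w 3 = 0 by linarith)).resolve_left hc
  · exact (mul_eq_zero.mp (show Real.sqrt 3 * v 7 * w 4 = 0 by linarith)).resolve_left hc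
  · exact (mul_eq_zero.mp (show Real.sqrt 3 * v 7 * w 5 = 0 by linarith)).resolve_left hc
  · exact (mul_eq_zero.mp (show Real.sqrt 3 * v 7 * w 6 = 0 by linarith)).resolve_left hc
  · exact hw7

lemma apply_eq_zero_of_eigenvectors {Λ : Matrix (Fin 8) (Fin 8) ℝ} {v : Fin 3 → Fin 8 → ℝ}
    (hv : ∀ k i, 3 ≤ i → v k i = 0) (hne : ∀ k, v k ≠ 0)
    (heig : ∀ k, ∃ μ : ℝ, Λ *ᵥ v k = μ • v k) (horth : ∀ k l, k ≠ l → v k ⬝ᵥ v l = 0)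
    {a i : Fin 8} (ha : 3 ≤ a) (hi : i < 3) : Λ a i = 0 := by
  set P : Matrix (Fin 3) (Fin 3) ℝ := Matrix.of fun k => ![v k 0, v k 1, v k 2] with hP
  have hdot : ∀ w k, w ⬝ᵥ v k = w 0 * v k 0 + w 1 * v k 1 + w 2 * v k 2 := fun w k => by
    simp [dotProduct, Fin.sum_univ_eight, hv]
  have hPP : P * Pᵀ = Matrix.diagonal fun k => v k ⬝ᵥ v k := by
    ext k l
    have h1 : (P * Pᵀ) k l = v k ⬝ᵥ v l := by
      rw [hdot, Matrix.mul_apply, Fin.sum_univ_three]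
      simp [hP]
    rw [h1, Matrix.diagonal_apply]
    split_ifs with h
    · rw [h]
    · exact horth k l h
  have hdet : P.det ≠ 0 := fun h0 => by
    have h1 := congrArg Matrix.det hPP
    rw [Matrix.det_mul, h0, zero_mul, Matrix.det_diagonal] at h1
    obtain ⟨k, -, hk⟩ := Finset.prod_eq_zero_iff.mp h1.symm
    exact hne k (dotProduct_self_eq_zero.mp hk)
  have h0 : P *ᵥ ![Λ a 0, Λ a 1, Λ a 2] = 0 := by
    ext k
    obtain ⟨μ, hμ⟩ := heig k
    have h1 := congrFun hμ a
    rw [Matrix.mulVec, hdot, Pi.smul_apply, hv k a ha, smul_zero] at h1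
    simp only [hP, Matrix.mulVec, dotProduct, Fin.sum_univ_three, Matrix.of_apply]
    simp
    linarith
  have h1 := Matrix.eq_zero_of_mulVec_eq_zero hdet h0
  have e0 := congrFun h1 0; have e1 := congrFun h1 1; have e2 := congrFun h1 2
  simp at e0 e1 e2
  fin_cases i <;> simp at hi <;> simp [e0, e1, e2]

lemma exists_cpRot_comm {Λ : Matrix (Fin 8) (Fin 8) ℝ} (hΛ : Λ.IsSymm)
    (h7 : ∀ i, i ≠ 7 → Λ i 7 = 0) (hblock : ∀ a i : Fin 8, 3 ≤ a → i < 3 → Λ a i = 0)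
    (hK1 : ∀ i, i ≠ 7 → Kvec Λ 1 i = 0) (hK2 : ∀ i, i ≠ 7 → Kvec Λ 2 i = 0) :
    ∃ (s z : ℂ) (hs : s * (starRingEnd ℂ) s = 1) (hz : z * (starRingEnd ℂ) z = 1),
      cpRot hs hz * Λ = Λ * cpRot hs hz := by
  have h7' : ∀ i, i ≠ 7 → Λ 7 i = 0 := fun i hi => by rw [hΛ.apply, h7 i hi]
  have hblock' : ∀ i a : Fin 8, i < 3 → 3 ≤ a → Λ i a = 0 := fun i a hi ha => by
    rw [hΛ.apply, hblock a i ha hi]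
  have e43 := hΛ.apply 3 4; have e53 := hΛ.apply 3 5; have e63 := hΛ.apply 3 6
  have e54 := hΛ.apply 4 5; have e64 := hΛ.apply 4 6; have e65 := hΛ.apply 5 6
  obtain ⟨k10, k11, k12⟩ := Kvec_apply hΛ (n := 1) (by simpa using h7)
  obtain ⟨k20, k21, k22⟩ := Kvec_apply hΛ (n := 2) (fun i hi => by
    rw [pow_two, Matrix.mul_apply]
    refine Finset.sum_eq_zero fun j _ => ?_
    by_cases hj : j = 7
    · rw [hj, h7 i hi, zero_mul]
    · rw [h7 j hj, mul_zero])
  rw [hK1 _ (by decide), pow_one] at k10 k11 k12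
  rw [hK2 _ (by decide), pow_two] at k20 k21 k22
  simp [Matrix.mul_apply, Fin.sum_univ_eight, hblock, h7, e43, e53, e63, e54, e64, e65]
    at k20 k21 k22
  have e46 : Λ 4 6 = -Λ 3 5 := by linarith
  have e45 : Λ 4 5 = Λ 3 6 := by linarith
  have e44 : Λ 4 4 = Λ 5 5 + Λ 6 6 - Λ 3 3 := by linarith
  rw [e46, e45, e44] at k20 k21 k22
  obtain ⟨x, y, hxy, hrel⟩ := exists_unit_relation
    (u := ![Λ 3 5, Λ 3 3 - Λ 5 5, Λ 3 4 + Λ 5 6])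
    (w := ![Λ 3 6, Λ 3 4 - Λ 5 6, Λ 6 6 - Λ 3 3]) (fun i j => by
      fin_cases i <;> fin_cases j <;> simp <;> linarith)
  have r0 := hrel 0; have r1 := hrel 1; have r2 := hrel 2
  simp at r0 r1 r2
  have hz : (⟨x, y⟩ : ℂ) * (starRingEnd ℂ) ⟨x, y⟩ = 1 := by
    rw [Complex.mul_conj, Complex.normSq_mk, hxy, Complex.ofReal_one]
  have hs : (1 : ℂ) * (starRingEnd ℂ) 1 = 1 := by simp
  refine ⟨1, ⟨x, y⟩, hs, hz, ?_⟩
  have hR := cpRot_mulVec hs hz (x := x) (y := y) (by simp) (by simp)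
  refine Matrix.ext_of_mulVec_single fun j => ?_
  rw [← Matrix.mulVec_mulVec, ← Matrix.mulVec_mulVec, hR, hR]
  generalize (Pi.single j 1 : Fin 8 → ℝ) = v
  ext i
  fin_cases i <;>
    simp [Matrix.mulVec, dotProduct, Fin.sum_univ_eight, hblock, hblock', h7, h7', e43, e53, e63,
      e54, e64, e65, e46, e45, e44]
  · ring
  · ring
  · ring
  · linear_combination 2 * v 3 * r0 - v 5 * r1 + v 6 * r2
  · linear_combination 2 * v 4 * r0 - v 5 * r2 - v 6 * r1
  · linear_combination -v 3 * r1 - v 4 * r2 - 2 * v 5 * r0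
  · linear_combination v 3 * r2 - v 4 * r1 - 2 * v 6 * r0

lemma exists_cpRot_of_invariantConditions {v M L : Fin 8 → ℝ} {Λ : Matrix (Fin 8) (Fin 8) ℝ}
    (hΛ : Λ.IsSymm) (hv : ∀ i, i ≠ 7 → v i = 0) (h : InvariantConditions v M L Λ) :
    ∃ (s z : ℂ) (hs : s * (starRingEnd ℂ) s = 1) (hz : z * (starRingEnd ℂ) z = 1),
      cpRot hs hz *ᵥ M = M ∧ cpRot hs hz *ᵥ L = L ∧ cpRot hs hz * Λ = Λ * cpRot hs hz := by
  obtain ⟨h8, ⟨μ, hμ⟩, -, ⟨v1, v2, v3, ⟨h1, e1⟩, ⟨h2, e2⟩, ⟨h3, e3⟩, h12, h13, h23, h18, h28, h38,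
    f1, f2, f3⟩, ⟨cM, rfl⟩, ⟨cL, rfl⟩, ⟨c1, hK1⟩, ⟨c2, hK2⟩⟩ := h
  have hv7 : v 7 ≠ 0 := fun h0 => by
    simp [Fin.sum_univ_eight, hv, h0] at h8
  have h7 : ∀ i, i ≠ 7 → Λ i 7 = 0 := fun i hi => by
    have := congrFun hμ i
    simpa [Matrix.mulVec, dotProduct, Fin.sum_univ_eight, hv, hi, hv7] using this
  have hblock : ∀ a i : Fin 8, 3 ≤ a → i < 3 → Λ a i = 0 := fun a i ha hi => by
    refine apply_eq_zero_of_eigenvectors (v := ![v1, v2, v3]) (fun k => ?_) (fun k => ?_)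
      (fun k => ?_) (fun k l hkl => ?_) ha hi
    · fin_cases k
      exacts [apply_eq_zero_of_fOrth hv hv7 h18 f1, apply_eq_zero_of_fOrth hv hv7 h28 f2,
        apply_eq_zero_of_fOrth hv hv7 h38 f3]
    · fin_cases k
      exacts [h1, h2, h3]
    · fin_cases k
      exacts [e1, e2, e3]
    · fin_cases k <;> fin_cases l <;> first | exact absurd rfl hkl | assumption | skip
      exacts [(dotProduct_comm _ _).trans h12, (dotProduct_comm _ _).trans h13,
        (dotProduct_comm _ _).trans h23]
  obtain ⟨s, z, hs, hz, hcomm⟩ := exists_cpRot_comm hΛ h7 hblock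
    (fun i hi => by rw [hK1, Pi.smul_apply, hv i hi, smul_zero])
    (fun i hi => by rw [hK2, Pi.smul_apply, hv i hi, smul_zero])
  have hfix : cpRot hs hz *ᵥ v = v := by
    rw [cpRot_mulVec hs hz rfl rfl]
    ext i
    fin_cases i <;> simp [hv]
  exact ⟨s, z, hs, hz, by rw [Matrix.mulVec_smul, hfix], by rw [Matrix.mulVec_smul, hfix], hcomm⟩

lemma exists_adHom_map_selfAligned {v : Fin 8 → ℝ} (hv : SelfAligned v) :
    ∃ (U : Matrix (Fin 3) (Fin 3) ℂ) (hU : U * Uᴴ = 1),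
      ∀ i, i ≠ 7 → ((rot (adHom U hU))ᵀ *ᵥ v) i = 0 := by
  obtain ⟨α, β, h⟩ := (selfAligned_iff v).mp hv
  obtain ⟨U, a, c, hU, hD⟩ := exists_unitary_diag (hmat_isHermitian v) h
  have hU1 := mul_eq_one_comm.mp hU
  have hU' : Uᴴ * Uᴴᴴ = 1 := by
    rw [Matrix.conjTranspose_conjTranspose, hU1]
  refine ⟨U, hU, fun i hi => ?_⟩
  have hw : hmat ((rot (adHom U hU))ᵀ *ᵥ v) = Matrix.diagonal ![(a : ℂ), (a : ℂ), (c : ℂ)] := by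
    rw [← adHom_conjTranspose_comp hU hU', ← map_hmat (trace_adHom hU'), adHom_apply, hD,
      Matrix.conjTranspose_conjTranspose]
    simp only [mul_assoc, hU1, mul_one]
    rw [← mul_assoc, hU1, one_mul]
  rw [← tcoef_hmat (_ *ᵥ v), hw, tcoef_eq]
  fin_cases i <;> simp at hi ⊢

/-- **Theorem 1.** The 3HDM potential with parameters `M0, Λ0, M, L, Λ` (with `Λ` symmetric)
admits a CP symmetry of order 4 iff: (i) `Λ` has a self-aligned unit eigenvector `v⁸`;
(ii) there exist three mutually orthogonal eigenvectors of `Λ`, each orthogonal and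
f-orthogonal to `v⁸`; (iii) `M`, `L`, `K⁽¹⁾`, `K⁽²⁾` are real scalar multiples of `v⁸`. -/
theorem cp4_basis_invariant_conditions
    (M0 Λ0 : ℝ) (M L : Fin 8 → ℝ) (Λ : Matrix (Fin 8) (Fin 8) ℝ) (hΛ : Λ.IsSymm) :
    HasCP4 M0 Λ0 M L Λ ↔
      ∃ v8 : Fin 8 → ℝ,
        (∑ i, v8 i ^ 2 = 1) ∧ (∃ μ : ℝ, Λ.mulVec v8 = μ • v8) ∧ SelfAligned v8 ∧
        (∃ v1 v2 v3 : Fin 8 → ℝ,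
          (v1 ≠ 0 ∧ ∃ μ : ℝ, Λ.mulVec v1 = μ • v1) ∧
          (v2 ≠ 0 ∧ ∃ μ : ℝ, Λ.mulVec v2 = μ • v2) ∧
          (v3 ≠ 0 ∧ ∃ μ : ℝ, Λ.mulVec v3 = μ • v3) ∧
          (∑ i, v1 i * v2 i = 0) ∧ (∑ i, v1 i * v3 i = 0) ∧ (∑ i, v2 i * v3 i = 0) ∧
          (∑ i, v1 i * v8 i = 0) ∧ (∑ i, v2 i * v8 i = 0) ∧ (∑ i, v3 i * v8 i = 0) ∧
          FOrth v8 v1 ∧ FOrth v8 v2 ∧ FOrth v8 v3) ∧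
        (∃ c : ℝ, M = c • v8) ∧ (∃ c : ℝ, L = c • v8) ∧
        (∃ c : ℝ, Kvec Λ 1 = c • v8) ∧ (∃ c : ℝ, Kvec Λ 2 = c • v8) := by
  change _ ↔ ∃ v8, InvariantConditions v8 M L Λ
  have hsymm : ∀ R : Matrix (Fin 8) (Fin 8) ℝ, (Rᵀ * Λ * R).IsSymm := fun R => by
    simpa only [Matrix.transpose_transpose] using isSymm_conj hΛ Rᵀ
  rw [hasCP4_iff_normal M0 Λ0 M L hΛ]
  constructor
  · rintro ⟨U, hU, s, z, hs, hz, hM, hL, hcomm⟩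
    have h := (invariantConditions_of_cpRot (hsymm _) hM hL hcomm).map (trace_adHom hU)
    have hO := rot_mul_rot_transpose (trace_adHom hU)
    set O := rot (adHom U hU)
    have hS : O * (Oᵀ * Λ * O) * Oᵀ = Λ := by
      simp only [mul_assoc, hO, mul_one]
      rw [← mul_assoc, hO, one_mul]
    rw [Matrix.mulVec_mulVec, Matrix.mulVec_mulVec, hO, Matrix.one_mulVec,
      Matrix.one_mulVec, hS] at h
    exact ⟨_, h⟩
  · rintro ⟨v8, h⟩
    obtain ⟨U, hU, hv⟩ := exists_adHom_map_selfAligned h.2.2.1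
    have hU' : Uᴴ * Uᴴᴴ = 1 := by
      rw [Matrix.conjTranspose_conjTranspose, mul_eq_one_comm.mp hU]
    have h' := h.map (trace_adHom hU')
    rw [adHom_conjTranspose_comp hU hU', Matrix.transpose_transpose] at h'
    obtain ⟨s, z, hs, hz, hc⟩ := exists_cpRot_of_invariantConditions (hsymm _) hv h'
    exact ⟨U, hU, s, z, hs, hz, hc⟩
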